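/- arXiv:math/0406607 — 11 statements merged into one kernel-verified Lean document; each statement's English description precedes it below -/
import Mathlib

section
/- Let p be a prime and let F be a free group on a set of generators. Then F is residually-p: the intersection of all normal subgroups of F whose index is a (finite) power of p is the trivial subgroup. -/
/-- A syllable decomposition of a free group element: exponents are nonzero and adjacent
generators are distinct. -/
theorem FreeGroup.exists_syllables {S : Type*} (x : FreeGroup S) :
    ∃ l : List (S × ℤ), l.IsChain (fun a b => a.1 ≠ b.1) ∧ (∀ a ∈ l, a.2 ≠ 0) ∧
      (l.map fun a => FreeGroup.of a.1 ^ a.2).prod = x := by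
  classical
  have cons_zpow (s : S) (m : ℤ) (l : List (S × ℤ)) (hl : l.IsChain (fun a b => a.1 ≠ b.1))
      (hn : ∀ a ∈ l, a.2 ≠ 0) :
      ∃ l' : List (S × ℤ), l'.IsChain (fun a b => a.1 ≠ b.1) ∧ (∀ a ∈ l', a.2 ≠ 0) ∧
        (l'.map fun a => FreeGroup.of a.1 ^ a.2).prod =
          FreeGroup.of s ^ m * (l.map fun a => FreeGroup.of a.1 ^ a.2).prod := by
    by_cases hm : m = 0
    · exact ⟨l, hl, hn, by simp [hm]⟩
    rcases l with _ | ⟨⟨s', n⟩, t⟩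
    · exact ⟨[(s, m)], by simp, by simpa using hm, by simp⟩
    by_cases hs : s = s'
    · subst hs
      by_cases hmn : m + n = 0
      · refine ⟨t, hl.tail, fun a ha => hn a (by simp [ha]), ?_⟩
        simp [← mul_assoc, ← zpow_add, hmn]
      · refine ⟨(s, m + n) :: t, ?_, ?_, ?_⟩
        · rw [List.isChain_cons] at hl ⊢
          exact hl
        · intro a ha
          rcases List.mem_cons.1 ha with rfl | ha
          · exact hmn
          · exact hn a (by simp [ha])
        · simp [← mul_assoc, ← zpow_add]
    · refine ⟨(s, m) :: (s', n) :: t, ?_, ?_, by simp⟩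
      · rw [List.isChain_cons]
        exact ⟨by simpa using hs, hl⟩
      · intro a ha
        rcases List.mem_cons.1 ha with rfl | ha
        · exact hm
        · exact hn a ha
  obtain ⟨L, rfl⟩ : ∃ L, FreeGroup.mk L = x := Quot.exists_rep x
  induction L with
  | nil => exact ⟨[], by simp, by simp, rfl⟩
  | cons a L ih =>
    obtain ⟨l, hl, hn, h⟩ := ih
    obtain ⟨s, b⟩ := a
    have hmul : FreeGroup.mk ((s, b) :: L) = FreeGroup.mk [(s, b)] * FreeGroup.mk L := by simp
    have hgen : FreeGroup.mk [(s, b)] = FreeGroup.of s ^ (if b then 1 else -1 : ℤ) := by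
      cases b <;> simp [FreeGroup.of, FreeGroup.inv_mk, FreeGroup.invRev]
    rw [hmul, hgen, ← h]
    exact cons_zpow s _ l hl hn

/-- In a ring where the prime `p` is nilpotent, unipotent elements have `p`-power order. -/
theorem IsNilpotent.exists_one_add_pow_prime_pow_eq_one {R : Type*} [Ring R] {p k : ℕ}
    (hp : p.Prime) (hk : (p : R) ^ k = 0) {N : R} (hN : IsNilpotent N) :
    ∃ m : ℕ, (1 + N) ^ p ^ m = 1 := by
  obtain ⟨n, hn⟩ := hN
  have hpn : N ^ p ^ n = 0 := pow_eq_zero_of_le (Nat.lt_pow_self hp.one_lt).le hn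
  obtain ⟨r, hr⟩ := exists_add_pow_prime_pow_eq hp (1 : Polynomial ℤ) Polynomial.X n
  have hdvd : (p : Polynomial ℤ) ∣ (1 + Polynomial.X) ^ p ^ n - (1 + Polynomial.X ^ p ^ n) :=
    ⟨Polynomial.X * r, by rw [hr, one_pow]; ring⟩
  obtain ⟨q, hq⟩ := dvd_sub_pow_of_dvd_sub hdvd k
  refine ⟨n + k, ?_⟩
  have h := congrArg (Polynomial.aeval N) hq
  simpa [hpn, pow_succ, hk, ← pow_mul, pow_add, sub_eq_zero] using h

namespace Matrix

/-- A matrix whose entries on and below the diagonal vanish is nilpotent. -/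
theorem isNilpotent_of_strictUpper {n : ℕ} {R : Type*} [Ring R] (N : Matrix (Fin n) (Fin n) R)
    (hN : ∀ i j, j ≤ i → N i j = 0) : IsNilpotent N := by
  have key (m : ℕ) : ∀ i j : Fin n, (j : ℕ) < i + m → (N ^ m) i j = 0 := by
    induction m with
    | zero =>
      intro i j h
      rw [pow_zero, one_apply_ne]
      rintro rfl
      simp at h
    | succ m ih =>
      intro i j h
      rw [pow_succ', mul_apply]
      refine Finset.sum_eq_zero fun k _ => ?_
      rcases le_or_gt k i with hk | hk
      · rw [hN i k hk, zero_mul]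
      · rw [ih k j (by have : (i : ℕ) < k := hk; omega), mul_zero]
  refine ⟨n, ?_⟩
  ext i j
  exact key n i j (by omega)

section Superdiagonal

variable {S : Type*} (R : Type*) [Ring R] (r : ℕ) (c : ℕ → Option S)

open Classical in
/-- The matrix with a `1` at each position `(i, i + 1)` labelled `s` by `c`, and `0` elsewhere. -/
noncomputable def superdiag (s : S) : Matrix (Fin (r + 1)) (Fin (r + 1)) R :=
  fun i j => if (j : ℕ) = i + 1 ∧ c i = some s then 1 else 0

variable {r c}

theorem superdiag_mul_apply_of_eq {s : S} (M : Matrix (Fin (r + 1)) (Fin (r + 1)) R)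
    {i i' j : Fin (r + 1)} (hi : (i' : ℕ) = i + 1) (hc : c i = some s) :
    (superdiag R r c s * M) i j = M i' j := by
  rw [mul_apply, Finset.sum_eq_single i']
  · simp [superdiag, hi, hc]
  · intro b _ hb
    have : (b : ℕ) ≠ i + 1 := fun h => hb (Fin.ext (h.trans hi.symm))
    simp [superdiag, this]
  · simp

theorem superdiag_mul_apply_eq_zero {s : S} (M : Matrix (Fin (r + 1)) (Fin (r + 1)) R)
    {i j : Fin (r + 1)} (h : ∀ i' : Fin (r + 1), (i' : ℕ) = i + 1 → c i = some s → M i' j = 0) :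
    (superdiag R r c s * M) i j = 0 := by
  rw [mul_apply]
  refine Finset.sum_eq_zero fun k _ => ?_
  by_cases hk : (k : ℕ) = i + 1 ∧ c i = some s
  · rw [h k hk.1 hk.2, mul_zero]
  · simp [superdiag, hk]

theorem superdiag_mul_self (hc : ∀ i s, c i = some s → c (i + 1) ≠ some s) (s : S) :
    superdiag R r c s * superdiag R r c s = 0 := by
  ext i j
  refine superdiag_mul_apply_eq_zero R _ fun i' hi' hs => ?_
  have := hc _ _ hs
  simp [superdiag, hi', this]

/-- The unipotent unit `1 + superdiag R r c s`. -/
noncomputable def superdiagUnit (hc : ∀ i s, c i = some s → c (i + 1) ≠ some s) (s : S) :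
    (Matrix (Fin (r + 1)) (Fin (r + 1)) R)ˣ where
  val := 1 + superdiag R r c s
  inv := 1 - superdiag R r c s
  val_inv := by
    have := superdiag_mul_self R (r := r) hc s
    noncomm_ring
    simp [this]
  inv_val := by
    have := superdiag_mul_self R (r := r) hc s
    noncomm_ring
    simp [this]

variable (hc : ∀ i s, c i = some s → c (i + 1) ≠ some s)

theorem val_superdiagUnit_zpow (s : S) (n : ℤ) :
    ((superdiagUnit R (r := r) hc s ^ n :) : Matrix (Fin (r + 1)) (Fin (r + 1)) R) =
      1 + n • superdiag R r c s := by
  have h0 := superdiag_mul_self R (r := r) hc s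
  induction n using Int.induction_on with
  | zero => simp
  | succ n ih =>
    rw [_root_.zpow_add_one, Units.val_mul, ih]
    simp only [superdiagUnit, mul_add, add_mul, smul_mul_assoc, h0, add_smul]
    simp
    abel
  | pred n ih =>
    rw [_root_.zpow_sub_one, Units.val_mul, ih]
    simp only [superdiagUnit, Units.inv_mk, mul_sub, add_mul, smul_mul_assoc, h0, sub_smul]
    simp
    abel

theorem prod_superdiagUnit_apply_last (l : List (S × ℤ)) (t : ℕ) (ht : t + l.length = r)
    (hl : ∀ i (hi : i < l.length), c (t + i) = some l[i].1) :
    let M : Matrix (Fin (r + 1)) (Fin (r + 1)) R :=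
      (l.map fun a => superdiagUnit R (r := r) hc a.1 ^ a.2).prod.val
    (∀ i : Fin (r + 1), (i : ℕ) < t → M i (Fin.last r) = 0) ∧
      ∀ i : Fin (r + 1), (i : ℕ) = t → M i (Fin.last r) = ((l.map Prod.snd).prod : ℤ) := by
  induction l generalizing t with
  | nil =>
    obtain rfl : t = r := by simpa using ht
    refine ⟨fun i hi => ?_, fun i hi => ?_⟩
    · simp only [List.map_nil, List.prod_nil, Units.val_one]
      exact one_apply_ne fun h => by simp [h] at hi
    · obtain rfl : i = Fin.last t := Fin.ext hi
      simp
  | cons a l ih =>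
    simp only [List.length_cons] at ht hl
    obtain ⟨ih₁, ih₂⟩ := ih (t + 1) (by omega) fun i hi => by
      have := hl (i + 1) (by omega)
      rw [add_assoc, add_comm 1 i]
      simpa using this
    have hct : c t = some a.1 := by simpa using hl 0 (by omega)
    simp only [List.map_cons, List.prod_cons, Units.val_mul, val_superdiagUnit_zpow, add_mul,
      one_mul, smul_mul_assoc, add_apply, smul_apply]
    refine ⟨fun i hi => ?_, fun i hi => ?_⟩
    · rw [ih₁ i (by omega), superdiag_mul_apply_eq_zero R _ fun i' hi' _ => ih₁ i' (by omega)]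
      simp
    · rw [ih₁ i (by omega), superdiag_mul_apply_of_eq R _ (i' := ⟨t + 1, by omega⟩)
        (by simp [hi]) (by rw [hi, hct]), ih₂ _ rfl]
      simp

theorem lift_superdiagUnit_apply (x : FreeGroup S) (i j : Fin (r + 1)) (hij : j ≤ i) :
    (FreeGroup.lift (superdiagUnit R (r := r) hc) x).val i j =
      (1 : Matrix (Fin (r + 1)) (Fin (r + 1)) R) i j := by
  have hX (s : S) (i j : Fin (r + 1)) (h : j ≤ i) : superdiag R r c s i j = 0 := by
    have h' : (j : ℕ) ≤ i := h
    have : (j : ℕ) ≠ i + 1 := by omega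
    simp [superdiag, this]
  induction x using FreeGroup.induction_on generalizing i j with
  | C1 => simp
  | of s => simp [superdiagUnit, hX s i j hij]
  | inv_of s _ => simp [superdiagUnit, hX s i j hij]
  | mul x y hx hy =>
    rw [map_mul, Units.val_mul, mul_apply, Finset.sum_eq_single i]
    · rw [hx i i le_rfl, one_apply_eq, one_mul, hy i j hij]
    · intro k _ hk
      rcases lt_or_gt_of_ne hk with hk | hk
      · rw [hx i k hk.le, one_apply_ne hk.ne', zero_mul]
      · rw [hy k j (hij.trans hk.le), one_apply_ne (hij.trans_lt hk).ne', mul_zero]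
    · simp

end Superdiagonal

end Matrix

/-- Every nontrivial element of a free group lies outside some normal subgroup of `p`-power
index. -/
theorem FreeGroup.exists_normal_index_eq_prime_pow_notMem {S : Type*} {p : ℕ} (hp : p.Prime)
    {x : FreeGroup S} (hx : x ≠ 1) :
    ∃ N : Subgroup (FreeGroup S), N.Normal ∧ (∃ k : ℕ, N.index = p ^ k) ∧ x ∉ N := by
  obtain ⟨l, hl, hn, rfl⟩ := FreeGroup.exists_syllables x
  have hl0 : l ≠ [] := by
    rintro rfl
    simp at hx
  have hz : (l.map Prod.snd).prod ≠ 0 := by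
    rw [Ne, List.prod_eq_zero_iff]
    simpa using fun s h => hn (s, 0) h rfl
  set z := (l.map Prod.snd).prod
  set k := z.natAbs
  have : NeZero (p ^ k) := ⟨(pow_pos hp.pos k).ne'⟩
  have : Fact p.Prime := ⟨hp⟩
  have hzk : (z : ZMod (p ^ k)) ≠ 0 := by
    rw [Ne, ZMod.intCast_zmod_eq_zero_iff_dvd, ← Int.natAbs_dvd_natAbs, Int.natAbs_natCast]
    exact fun h => (Nat.le_of_dvd (Int.natAbs_pos.2 hz) h).not_gt (Nat.lt_pow_self hp.one_lt)
  let c : ℕ → Option S := fun i => l[i]?.map Prod.fst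
  have hc (i : ℕ) (s : S) (h : c i = some s) : c (i + 1) ≠ some s := by
    intro h'
    simp only [c, Option.map_eq_some_iff, List.getElem?_eq_some_iff] at h h'
    obtain ⟨_, ⟨hi, rfl⟩, hs⟩ := h
    obtain ⟨_, ⟨hi', rfl⟩, hs'⟩ := h'
    exact List.isChain_iff_getElem.1 hl i hi' (hs.trans hs'.symm)
  let φ := FreeGroup.lift (Matrix.superdiagUnit (ZMod (p ^ k)) (r := l.length) hc)
  have hφ : IsPGroup p φ.range := by
    rintro ⟨_, y, rfl⟩
    have hnil : IsNilpotent ((φ y).val - 1) := by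
      refine Matrix.isNilpotent_of_strictUpper _ fun i j hij => ?_
      rw [Matrix.sub_apply, Matrix.lift_superdiagUnit_apply _ hc y i j hij, sub_self]
    have hpk : ((p : ℕ) : Matrix (Fin (l.length + 1)) (Fin (l.length + 1)) (ZMod (p ^ k))) ^ k
        = 0 := by
      rw [← Nat.cast_pow]
      exact CharP.cast_eq_zero _ _
    obtain ⟨m, hm⟩ := hnil.exists_one_add_pow_prime_pow_eq_one hp hpk
    refine ⟨m, Subtype.ext (Units.ext ?_)⟩
    simpa using hm
  refine ⟨φ.ker, inferInstance, ?_, fun h => ?_⟩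
  · rw [Subgroup.index_ker]
    exact IsPGroup.iff_card.1 hφ
  · have hprod := (Matrix.prod_superdiagUnit_apply_last (ZMod (p ^ k)) (r := l.length) hc l 0
      (by simp)
      (fun i hi => by simp [c, hi])).2 0 rfl
    have hone : (l.map fun a => Matrix.superdiagUnit (ZMod (p ^ k)) (r := l.length) hc a.1
        ^ a.2).prod = 1 := by
      rw [MonoidHom.mem_ker, map_list_prod, List.map_map] at h
      simpa [φ, Function.comp_def] using h
    rw [hone, Units.val_one, Matrix.one_apply_ne] at hprod
    · exact hzk hprod.symm
    · intro h0
      exact hl0 (List.length_eq_zero_iff.1 (congrArg Fin.val h0).symm)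


/-- **Residual p-ness of free groups.** For any prime `p` and any free group `F`
on a set of generators `S`, the intersection of all normal subgroups of `F` of
`p`-power index is trivial. -/
theorem freeGroup_residually_p (S : Type*) (p : ℕ) (hp : p.Prime) :
    (⨅ N ∈ {N : Subgroup (FreeGroup S) | N.Normal ∧ ∃ k : ℕ, N.index = p ^ k}, N) = ⊥ := by
  refine (Subgroup.eq_bot_iff_forall _).2 fun x hx => by_contra fun hne => ?_
  obtain ⟨N, hN, hk, hxN⟩ := FreeGroup.exists_normal_index_eq_prime_pow_notMem hp hne
  simp only [Subgroup.mem_iInf] at hx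
  exact hxN (hx N ⟨hN, hk⟩)
end

section
/- Let p be a prime, let r ≥ 2, and let F = F_r be the free group on r generators. If α is an automorphism of F such that α(N) = N for every normal subgroup N of F of p-power index, then α is an inner automorphism of F. -/
open Subgroup

theorem apply_mem_iff_of_isPGroup {p : ℕ} (hp : p.Prime) {F : Type*} [Group F] {α : MulAut F}
    (hα : ∀ N : Subgroup F, N.Normal → (∃ k : ℕ, N.index = p ^ k) →
      Subgroup.map α.toMonoidHom N = N)
    {G : Type*} [Group G] [Finite G] (hG : IsPGroup p G) (ρ : F →* G) (B : Subgroup G) [B.Normal]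
    (x : F) : ρ (α x) ∈ B ↔ ρ x ∈ B := by
  have := Fact.mk hp
  have hidx : ∃ k : ℕ, (B.comap ρ).index = p ^ k := by
    obtain ⟨n, hn⟩ := hG.exists_card_eq
    have h : (B.comap ρ).index ∣ p ^ n := by
      rw [Subgroup.index_comap, ← hn]
      exact (Subgroup.relIndex_dvd_index_of_normal _ _).trans B.index_dvd_card
    obtain ⟨k, -, hk⟩ := (Nat.dvd_prime_pow hp).1 h
    exact ⟨k, hk⟩
  have h := hα (B.comap ρ) inferInstance hidx
  change α x ∈ B.comap ρ ↔ x ∈ B.comap ρ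
  conv_lhs => rw [← h]
  exact Subgroup.mem_map_iff_mem α.injective

theorem apply_eq_one_iff_of_isPGroup {p : ℕ} (hp : p.Prime) {F : Type*} [Group F] {α : MulAut F}
    (hα : ∀ N : Subgroup F, N.Normal → (∃ k : ℕ, N.index = p ^ k) →
      Subgroup.map α.toMonoidHom N = N)
    {G : Type*} [Group G] [Finite G] (hG : IsPGroup p G) (ρ : F →* G)
    (x : F) : ρ (α x) = 1 ↔ ρ x = 1 := by
  simpa using apply_mem_iff_of_isPGroup hp hα hG ρ ⊥ x

section ExponentSum

variable {ι : Type*} [DecidableEq ι]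

/-- The exponent sum of the generator `i`. -/
def exponentSum (i : ι) : FreeGroup ι →* Multiplicative ℤ :=
  FreeGroup.lift fun j => if j = i then Multiplicative.ofAdd 1 else 1

@[simp]
theorem exponentSum_of_self (i : ι) :
    exponentSum i (FreeGroup.of i) = Multiplicative.ofAdd 1 := by
  simp [exponentSum]

theorem exponentSum_of_ne {i j : ι} (h : j ≠ i) : exponentSum i (FreeGroup.of j) = 1 := by
  simp [exponentSum, h]

theorem isPGroup_multiplicative_zmod {p : ℕ} (hp : p.Prime) (k : ℕ) :
    IsPGroup p (Multiplicative (ZMod (p ^ k))) := by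
  have := Fact.mk hp
  exact IsPGroup.of_card (n := k) (by simp)

theorem exponentSum_apply_eq_one {p : ℕ} (hp : p.Prime) {α : MulAut (FreeGroup ι)}
    (hα : ∀ N : Subgroup (FreeGroup ι), N.Normal → (∃ k : ℕ, N.index = p ^ k) →
      Subgroup.map α.toMonoidHom N = N)
    {i : ι} {x : FreeGroup ι} (hx : exponentSum i x = 1) : exponentSum i (α x) = 1 := by
  set e : ℤ := (exponentSum i (α x)).toAdd with he
  have hdvd (k : ℕ) : ((p ^ k : ℕ) : ℤ) ∣ e := by
    have : NeZero (p ^ k) := ⟨pow_ne_zero _ hp.ne_zero⟩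
    let ρ : FreeGroup ι →* Multiplicative (ZMod (p ^ k)) :=
      (AddMonoidHom.toMultiplicative (Int.castAddHom (ZMod (p ^ k)))).comp (exponentSum i)
    have h : ρ (α x) = 1 :=
      (apply_eq_one_iff_of_isPGroup hp hα (isPGroup_multiplicative_zmod hp k) ρ x).2
        (by simp [ρ, hx])
    rw [← ZMod.intCast_zmod_eq_zero_iff_dvd]
    exact h
  have h0 : e = 0 := by
    refine Int.eq_zero_of_abs_lt_dvd (hdvd e.natAbs) ?_
    rw [Int.abs_eq_natAbs]
    exact_mod_cast Nat.lt_pow_self hp.one_lt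
  exact h0

theorem exists_not_pow_dvd_sub_one {p : ℕ} (hp : p.Prime) {n : ℕ} (hn : n ≠ 0) :
    ∃ k ≠ 0, ¬ p ^ k ∣ (1 + p) ^ n - 1 := by
  have h2 : 1 < (1 + p) ^ n := Nat.one_lt_pow hn (by have := hp.pos; omega)
  refine ⟨(1 + p) ^ n, by omega, fun h => ?_⟩
  have h1 := Nat.le_of_dvd (by omega) h
  have := Nat.lt_pow_self (n := (1 + p) ^ n) hp.one_lt
  omega

/-- Multiplication by `1 + p` as a unit of `ZMod (p ^ k)`. -/
def onePlusUnit (p k : ℕ) : (ZMod (p ^ k))ˣ :=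
  ZMod.unitOfCoprime (1 + p) (Nat.Coprime.pow_right k (by simp))

theorem onePlusUnit_pow_eq_one_iff {p k n : ℕ} :
    onePlusUnit p k ^ n = 1 ↔ p ^ k ∣ (1 + p) ^ n - 1 := by
  rw [Units.ext_iff, ← ZMod.natCast_eq_zero_iff, Nat.cast_sub (Nat.one_le_pow _ _ (by omega)),
    sub_eq_zero]
  simp [onePlusUnit]

theorem onePlusUnit_pow_pow_eq_one {p : ℕ} (k : ℕ) : onePlusUnit p k ^ p ^ k = 1 := by
  rw [onePlusUnit_pow_eq_one_iff]
  have h : ((p : ℕ) : ℤ) ∣ (1 + p : ℤ) - 1 := by simp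
  have h' := dvd_sub_pow_of_dvd_sub h k
  rw [← Int.natCast_dvd_natCast, Nat.cast_sub (Nat.one_le_pow _ _ (by omega))]
  refine Dvd.dvd.trans ?_ (by simpa using h')
  push_cast
  exact pow_dvd_pow _ (by omega)

theorem isPGroup_zpowers_onePlusUnit (p k : ℕ) : IsPGroup p (zpowers (onePlusUnit p k)) := by
  rintro ⟨_, m, rfl⟩
  refine ⟨k, Subtype.ext ?_⟩
  change (onePlusUnit p k ^ m) ^ p ^ k = 1
  rw [← zpow_natCast, zpow_comm, zpow_natCast, onePlusUnit_pow_pow_eq_one, one_zpow]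

theorem isUnit_of_pow_smul_ne_zero {p k : ℕ} (hp : p.Prime) (t : ZMod (p ^ (k + 1)))
    (ht : p ^ k • t ≠ 0) : IsUnit t := by
  have : NeZero (p ^ (k + 1)) := ⟨pow_ne_zero _ hp.ne_zero⟩
  rw [← ZMod.natCast_zmod_val t, ZMod.isUnit_iff_coprime]
  refine Nat.Coprime.pow_right _ ((Nat.coprime_comm.1 ((hp.coprime_iff_not_dvd).2 fun h => ht ?_)))
  obtain ⟨c, hc⟩ := h
  rw [← ZMod.natCast_zmod_val t, hc, nsmul_eq_mul, ← Nat.cast_mul, ← mul_assoc, ← pow_succ,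
    Nat.cast_mul, ZMod.natCast_self, zero_mul]

theorem isPGroup_semidirectProduct {p : ℕ} (hp : p.Prime) {N U : Type*} [Group N] [Group U]
    [Finite N] [Finite U] (hN : IsPGroup p N) (hU : IsPGroup p U) (φ : U →* MulAut N) :
    IsPGroup p (N ⋊[φ] U) := by
  have := Fact.mk hp
  obtain ⟨m, hm⟩ := hN.exists_card_eq
  obtain ⟨n, hn⟩ := hU.exists_card_eq
  exact IsPGroup.of_card (n := m + n) (by rw [SemidirectProduct.card, hm, hn, pow_add])

/-- Let `ρ` send the generator `i` to `u`, the generator `j` to `n` and all others to `1` in a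
semidirect product `N ⋊ U`. If `u` acts on `n` as raising to the power `m`, then the linear part
of `ρ (α i)` acts on the translation part of `ρ (α j)` as raising to the power `m`. -/
theorem exists_apply_eq_pow_of_semidirectProduct {p : ℕ} (hp : p.Prime)
    {α : MulAut (FreeGroup ι)}
    (hα : ∀ N : Subgroup (FreeGroup ι), N.Normal → (∃ k : ℕ, N.index = p ^ k) →
      Subgroup.map α.toMonoidHom N = N)
    {i j : ι} (hij : i ≠ j) {N U : Type*} [CommGroup N] [Group U] [Finite N] [Finite U]
    (hN : IsPGroup p N) (hU : IsPGroup p U) (φ : U →* MulAut N) (n : N) (u : U) (m : ℕ)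
    (h : φ u n = n ^ m) :
    ∃ t : N, (∀ q : ℕ, t ^ q = 1 ↔ n ^ q = 1) ∧
      φ (u ^ (exponentSum i (α (FreeGroup.of i))).toAdd) t = t ^ m := by
  have : Finite (N ⋊[φ] U) := Finite.of_equiv _ SemidirectProduct.equivProd.symm
  have hG := isPGroup_semidirectProduct hp hN hU φ
  let ρ : FreeGroup ι →* N ⋊[φ] U := FreeGroup.lift fun l =>
    if l = i then SemidirectProduct.inr u else if l = j then SemidirectProduct.inl n else 1
  have hρi : ρ (FreeGroup.of i) = SemidirectProduct.inr u := by simp [ρ]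
  have hρj : ρ (FreeGroup.of j) = SemidirectProduct.inl n := by simp [ρ, hij.symm]
  have hright (x : FreeGroup ι) : (ρ x).right = u ^ (exponentSum i x).toAdd := by
    have : SemidirectProduct.rightHom.comp ρ = (zpowersHom _ u).comp (exponentSum i) := by
      ext l
      by_cases hl : l = i
      · simp [ρ, exponentSum, hl]
      · by_cases hl' : l = j <;> simp [ρ, exponentSum, hl, hl', hij.symm]
    exact DFunLike.congr_fun this x
  obtain ⟨t, ht⟩ : ∃ t, ρ (α (FreeGroup.of j)) = SemidirectProduct.inl t := by
    refine ⟨(ρ (α (FreeGroup.of j))).left, SemidirectProduct.ext rfl ?_⟩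
    rw [hright, exponentSum_apply_eq_one hp hα (exponentSum_of_ne hij.symm)]
    simp
  refine ⟨t, fun q => ?_, ?_⟩
  · have h1 := apply_eq_one_iff_of_isPGroup hp hα hG ρ (FreeGroup.of j ^ q)
    rwa [map_pow, map_pow, map_pow, ht, hρj, ← map_pow, ← map_pow,
      ← map_one SemidirectProduct.inl, SemidirectProduct.inl_inj, SemidirectProduct.inl_inj] at h1
  · have h1 := (apply_eq_one_iff_of_isPGroup hp hα hG ρ
      (FreeGroup.of i * FreeGroup.of j * (FreeGroup.of i)⁻¹ * (FreeGroup.of j ^ m)⁻¹)).2 (by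
        simp only [map_mul, map_inv, map_pow, hρi, hρj]
        rw [← map_inv SemidirectProduct.inr, ← SemidirectProduct.inl_aut, h, map_pow,
          mul_inv_cancel])
    simp only [map_mul, map_inv, map_pow, ht] at h1
    rw [mul_inv_eq_one, mul_inv_eq_iff_eq_mul] at h1
    have h2 := congrArg SemidirectProduct.left h1
    rw [← map_pow] at h2
    simp only [SemidirectProduct.mul_left, SemidirectProduct.left_inl, SemidirectProduct.right_inl,
      map_one, MulAut.one_apply, hright] at h2
    rw [mul_comm] at h2
    exact mul_right_cancel h2

theorem exponentSum_apply_of_self {p : ℕ} (hp : p.Prime) {α : MulAut (FreeGroup ι)}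
    (hα : ∀ N : Subgroup (FreeGroup ι), N.Normal → (∃ k : ℕ, N.index = p ^ k) →
      Subgroup.map α.toMonoidHom N = N)
    {i j : ι} (hij : i ≠ j) :
    exponentSum i (α (FreeGroup.of i)) = Multiplicative.ofAdd 1 := by
  set e : ℤ := (exponentSum i (α (FreeGroup.of i))).toAdd with he
  have key (k : ℕ) : onePlusUnit p (k + 1) ^ e = onePlusUnit p (k + 1) := by
    set u := onePlusUnit p (k + 1) with hu
    have : NeZero (p ^ (k + 1)) := ⟨pow_ne_zero _ hp.ne_zero⟩
    obtain ⟨t, ht1, ht2⟩ := exists_apply_eq_pow_of_semidirectProduct hp hα hij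
      (isPGroup_multiplicative_zmod hp (k + 1)) (isPGroup_zpowers_onePlusUnit p (k + 1))
      ((MulAutMultiplicative (ZMod (p ^ (k + 1)))).symm.toMonoidHom.comp
        (AddAut.mulLeft.comp (zpowers u).subtype))
      (Multiplicative.ofAdd 1) ⟨u, mem_zpowers u⟩ (1 + p) (by
        rw [← ofAdd_nsmul]
        change Multiplicative.ofAdd ((u : ZMod (p ^ (k + 1))) * 1) = _
        simp [hu, onePlusUnit])
    have htu : IsUnit t.toAdd := by
      refine isUnit_of_pow_smul_ne_zero hp _ fun h0 => ?_
      have h1 := (ht1 (p ^ k)).1 h0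
      rw [← ofAdd_nsmul, ofAdd_eq_one, nsmul_one, ZMod.natCast_eq_zero_iff,
        Nat.pow_dvd_pow_iff_le_right hp.one_lt] at h1
      omega
    rw [← he] at ht2
    have h2 : ((u ^ e : (ZMod (p ^ (k + 1)))ˣ) : ZMod (p ^ (k + 1))) * t.toAdd =
      (1 + p) • t.toAdd := ht2
    rw [nsmul_eq_mul] at h2
    refine Units.ext ((htu.mul_left_inj.1 h2).trans ?_)
    simp [hu, onePlusUnit]
  by_contra hne
  have hn : (e - 1).natAbs ≠ 0 := by
    rw [Int.natAbs_ne_zero, sub_ne_zero]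
    exact hne
  obtain ⟨k, hk, hdvd⟩ := exists_not_pow_dvd_sub_one hp hn
  obtain ⟨k, rfl⟩ := Nat.exists_eq_succ_of_ne_zero hk
  refine hdvd (onePlusUnit_pow_eq_one_iff.1 ?_)
  rw [pow_natAbs_eq_one, zpow_sub_one, key, mul_inv_cancel]

end ExponentSum

section WreathProduct

open scoped RegularWreathProduct

namespace RegularWreathProduct

variable {D Q : Type*} [CommGroup D] [Group Q]

/-- The product of all coordinates, as a homomorphism. -/
def prodLeft [Fintype Q] : D ≀ᵣ Q →* D where
  toFun a := ∏ g, a.left g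
  map_one' := by simp
  map_mul' a b := by
    simp only [mul_left, Pi.mul_apply, Finset.prod_mul_distrib]
    congr 1
    exact Fintype.prod_equiv (Equiv.mulLeft a.right⁻¹) _ _ fun _ => rfl

/-- The elements of the base group that are invariant under right translation by `x`. -/
def rightInvariant (D : Type*) [CommGroup D] (x : Q) : Subgroup (D ≀ᵣ Q) where
  carrier := {a | a.right = 1 ∧ ∀ g, a.left (g * x) = a.left g}
  one_mem' := by simp
  mul_mem' := by
    rintro a b ⟨ha, ha'⟩ ⟨hb, hb'⟩
    exact ⟨by simp [ha, hb], fun g => by simp [ha, ha', hb']⟩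
  inv_mem' := by
    rintro a ⟨ha, ha'⟩
    exact ⟨by simp [ha], fun g => by simp [ha, ha']⟩

theorem mem_rightInvariant {x : Q} {a : D ≀ᵣ Q} :
    a ∈ rightInvariant D x ↔ a.right = 1 ∧ ∀ g, a.left (g * x) = a.left g := Iff.rfl

instance (x : Q) : (rightInvariant D x).Normal where
  conj_mem := by
    rintro a ⟨ha, ha'⟩ b
    exact ⟨by simp [ha], fun g => by simp [ha, ← mul_assoc, ha']⟩

theorem pow_left_inv_mul {b : D ≀ᵣ Q} {n : ℕ} (h : (b ^ n).right = 1) (g : Q) :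
    (b ^ n).left (b.right⁻¹ * g) = (b ^ n).left g := by
  have h1 := congrFun (congrArg left ((Commute.refl b).pow_right n).eq) g
  simp only [mul_left, Pi.mul_apply, h, inv_one, one_mul] at h1
  rw [mul_comm] at h1
  exact mul_right_cancel h1

theorem pow_mem_rightInvariant {b : D ≀ᵣ Q} (hb : ∀ g ≠ 1, b.left g = 1) {n : ℕ}
    (h : (b ^ n).right = 1) : b ^ n ∈ rightInvariant D b.right := by
  have hsupp (k : ℕ) : (b ^ k).right ∈ zpowers b.right ∧
      ∀ g ∉ zpowers b.right, (b ^ k).left g = 1 := by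
    induction k with
    | zero => simp
    | succ k ih =>
      refine ⟨by simpa [pow_succ] using mul_mem ih.1 (mem_zpowers _), fun g hg => ?_⟩
      rw [pow_succ', mul_left, Pi.mul_apply, hb g (by rintro rfl; exact hg (one_mem _)), one_mul]
      exact ih.2 _ fun h' => hg <| by
        simpa using mul_mem (mem_zpowers b.right) h'
  refine ⟨h, fun g => ?_⟩
  by_cases hg : g ∈ zpowers b.right
  · have hcomm : g * b.right = b.right * g := by
      obtain ⟨m, rfl⟩ := hg
      exact ((Commute.refl b.right).zpow_left m).eq
    rw [hcomm, ← pow_left_inv_mul h (b.right * g), inv_mul_cancel_left]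
  · rw [(hsupp n).2 g hg, (hsupp n).2]
    exact fun h' => hg <| by simpa using mul_mem h' (inv_mem (mem_zpowers b.right))

theorem isPGroup {p : ℕ} (hp : p.Prime) [Finite D] [Finite Q] (hD : IsPGroup p D)
    (hQ : IsPGroup p Q) : IsPGroup p (D ≀ᵣ Q) := by
  have := Fact.mk hp
  obtain ⟨m, hm⟩ := hD.exists_card_eq
  obtain ⟨n, hn⟩ := hQ.exists_card_eq
  exact IsPGroup.of_card (n := m * p ^ n + n) (by rw [card, hm, hn, pow_add, pow_mul])

end RegularWreathProduct

theorem sum_eq_zero_of_pow_dvd_card_orbit {A X M : Type*} [Group A] [MulAction A X]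
    [Fintype X] [AddCommMonoid M] {n : ℕ} (v : X → M) (hv : ∀ (a : A) x, v (a • x) = v x)
    (hn : ∀ x : X, n ∣ Nat.card (MulAction.orbit A x)) (hM : ∀ m : M, n • m = 0) :
    ∑ x, v x = 0 := by
  classical
  rw [← Fintype.sum_equiv (MulAction.selfEquivSigmaOrbits A X).symm
    (fun y => v ((MulAction.selfEquivSigmaOrbits A X).symm y)) v fun _ => rfl, Fintype.sum_sigma]
  refine Finset.sum_eq_zero fun ω _ => ?_
  have hconst (y : MulAction.orbit A ω.out) :
      v ((MulAction.selfEquivSigmaOrbits A X).symm ⟨ω, y⟩) = v ω.out := by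
    obtain ⟨_, a, rfl⟩ := y
    exact hv a _
  rw [Finset.sum_congr rfl fun y _ => hconst y, Finset.sum_const, Finset.card_univ]
  obtain ⟨c, hc⟩ := hn ω.out
  rw [← Nat.card_eq_fintype_card, hc, mul_comm, mul_nsmul', hM, nsmul_zero]

/-- If `v` is left invariant under `w`, right invariant under `x` and has sum which is not a
multiple of `p * orderOf x`, then `w` is conjugate into `⟨x⟩`. -/
theorem exists_conj_mem_zpowers_of_sum_ne_zero {p : ℕ} (hp : p.Prime) {G : Type*} [Group G]
    [Fintype G] (hG : IsPGroup p G) {M : Type*} [AddCommMonoid M] (x w : G)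
    (hM : ∀ m : M, (p * orderOf x) • m = 0) (v : G → M) (hw : ∀ g, v (w * g) = v g)
    (hx : ∀ g, v (g * x) = v g) (hv : ∑ g, v g ≠ 0) : ∃ g, g⁻¹ * w * g ∈ zpowers x := by
  classical
  by_contra! hcon
  have := Fact.mk hp
  apply hv
  let φ : zpowers w × zpowers x →* Equiv.Perm G :=
    { toFun := fun a =>
        (Equiv.mulLeft (a.1 : G)).trans (Equiv.mulRight (a.2 : G)⁻¹)
      map_one' := by ext; simp
      map_mul' := fun a b => by ext; simp [mul_assoc] }
  let _ : MulAction (zpowers w × zpowers x) G := MulAction.compHom G φ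
  have hsmul (a : zpowers w × zpowers x) (g : G) : a • g = a.1 * g * (a.2 : G)⁻¹ := rfl
  have hA : IsPGroup p (zpowers w × zpowers x) := by
    obtain ⟨m, hm⟩ := (hG.to_subgroup (zpowers w)).exists_card_eq
    obtain ⟨n, hn⟩ := (hG.to_subgroup (zpowers x)).exists_card_eq
    exact IsPGroup.of_card (n := m + n) (by rw [Nat.card_prod, hm, hn, pow_add])
  refine sum_eq_zero_of_pow_dvd_card_orbit (A := zpowers w × zpowers x) (n := p * orderOf x) v
    (fun a g => ?_) (fun g => ?_) hM
  · have h1 (b : G) (hb : b ∈ zpowers w) (g : G) : v (b * g) = v g := by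
      obtain ⟨n, rfl⟩ := mem_zpowers_iff_mem_range_orderOf.1 hb |> Finset.mem_image.1 |>.imp
        fun _ h => h.2
      induction n with
      | zero => simp
      | succ n ih =>
        rw [pow_succ', mul_assoc, hw, ih (npow_mem_zpowers _ _)]
    have h2 (b : G) (hb : b ∈ zpowers x) (g : G) : v (g * b) = v g := by
      obtain ⟨n, rfl⟩ := mem_zpowers_iff_mem_range_orderOf.1 hb |> Finset.mem_image.1 |>.imp
        fun _ h => h.2
      induction n with
      | zero => simp
      | succ n ih =>
        rw [pow_succ, ← mul_assoc, hx, ih (npow_mem_zpowers _ _)]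
    rw [hsmul, h2 _ (inv_mem a.2.2), h1 _ a.1.2]
  · obtain ⟨n, hn⟩ := hA.card_orbit g
    obtain ⟨m, hm⟩ := (hG.to_subgroup (zpowers x)).exists_card_eq
    rw [Nat.card_zpowers] at hm
    have hlt : orderOf x < Nat.card (MulAction.orbit (zpowers w × zpowers x) g) := by
      have hsub : insert (w * g) ((fun b => g * b) '' (zpowers x : Set G)) ⊆
          MulAction.orbit (zpowers w × zpowers x) g := by
        rintro _ (rfl | ⟨b, hb, rfl⟩)
        · exact ⟨(⟨w, mem_zpowers w⟩, 1), by simp [hsmul]⟩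
        · exact ⟨(1, ⟨b, hb⟩⁻¹), by simp [hsmul]⟩
      have hnot : w * g ∉ (fun b => g * b) '' (zpowers x : Set G) := by
        rintro ⟨b, hb, hb'⟩
        refine hcon g ?_
        rw [mul_assoc, ← hb']
        simpa using hb
      have h1 := Set.ncard_le_ncard hsub (Set.toFinite _)
      rw [Set.ncard_insert_of_notMem hnot (Set.toFinite _),
        Set.ncard_image_of_injective _ (mul_right_injective g)] at h1
      rw [Nat.card_coe_set_eq, ← Nat.card_zpowers]
      exact h1
    rw [hn, hm, ← pow_succ']
    rw [hn, hm, Nat.pow_lt_pow_iff_right hp.one_lt] at hlt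
    exact pow_dvd_pow _ hlt

/-- If some lift of `ρ` to a wreath product has trivial coordinates on `f` except for one, and
the product of the coordinates of `α f` is a generator, then `ρ (α f)` is conjugate into the
subgroup generated by `ρ f`. -/
theorem exists_conj_mem_zpowers {p : ℕ} (hp : p.Prime) {F : Type*} [Group F] {α : MulAut F}
    (hα : ∀ N : Subgroup F, N.Normal → (∃ k : ℕ, N.index = p ^ k) →
      Subgroup.map α.toMonoidHom N = N)
    {G : Type*} [Group G] [Fintype G] (hG : IsPGroup p G) (ρ : F →* G) (f : F)
    (hρ : ∀ l : ℕ, ∃ Φ : F →* Multiplicative (ZMod (p ^ l)) ≀ᵣ G, (∀ x, (Φ x).right = ρ x) ∧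
      (∀ g ≠ 1, (Φ f).left g = 1) ∧
      RegularWreathProduct.prodLeft (Φ (α f)) = Multiplicative.ofAdd 1) :
    ∃ g, g⁻¹ * ρ (α f) * g ∈ zpowers (ρ f) := by
  have := Fact.mk hp
  obtain ⟨m, hm⟩ := (hG.to_subgroup (zpowers (ρ f))).exists_card_eq
  rw [Nat.card_zpowers] at hm
  have : NeZero (p ^ (m + 1)) := ⟨pow_ne_zero _ hp.ne_zero⟩
  obtain ⟨Φ, hΦ, hf, hαf⟩ := hρ (m + 1)
  have hmem : Φ (f ^ p ^ m) ∈ RegularWreathProduct.rightInvariant _ (ρ f) := by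
    rw [map_pow, ← hΦ]
    refine RegularWreathProduct.pow_mem_rightInvariant hf ?_
    rw [← map_pow, hΦ, map_pow, ← hm, pow_orderOf_eq_one]
  rw [← apply_mem_iff_of_isPGroup hp hα
    (RegularWreathProduct.isPGroup hp (isPGroup_multiplicative_zmod hp (m + 1)) hG), map_pow,
    map_pow] at hmem
  obtain ⟨h1, h2⟩ := RegularWreathProduct.mem_rightInvariant.1 hmem
  refine exists_conj_mem_zpowers_of_sum_ne_zero hp hG (M := ZMod (p ^ (m + 1))) (ρ f) (ρ (α f))
    (fun a => ?_) (fun g => ((Φ (α f) ^ p ^ m).left g).toAdd) (fun g => ?_) (fun g => ?_) ?_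
  · rw [hm, ← pow_succ', nsmul_eq_mul, ZMod.natCast_self, zero_mul]
  · have := RegularWreathProduct.pow_left_inv_mul h1 (ρ (α f) * g)
    rw [hΦ, inv_mul_cancel_left] at this
    rw [this]
  · rw [h2]
  · intro h0
    have h3 := map_pow (RegularWreathProduct.prodLeft (D := Multiplicative (ZMod (p ^ (m + 1))))
      (Q := G)) (Φ (α f)) (p ^ m)
    rw [hαf, ← ofAdd_nsmul, nsmul_one] at h3
    have h4 : ((p ^ m : ℕ) : ZMod (p ^ (m + 1))) = 0 := by
      have h5 := congrArg Multiplicative.toAdd h3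
      rw [toAdd_ofAdd] at h5
      rw [← h5, ← h0]
      exact toAdd_prod _ _
    rw [ZMod.natCast_eq_zero_iff, Nat.pow_dvd_pow_iff_le_right hp.one_lt] at h4
    omega

end WreathProduct

section Conjugacy

variable {ι : Type*} [DecidableEq ι]

open scoped RegularWreathProduct in
/-- A lift of `ρ` to a wreath product for which the product of coordinates is the exponent sum of
the generator `i` modulo `p ^ l`. -/
theorem exists_lift_regularWreathProduct {G : Type*} [Group G] [Fintype G] (p : ℕ) (i : ι)
    (ρ : FreeGroup ι →* G) (l : ℕ) :
    ∃ Φ : FreeGroup ι →* Multiplicative (ZMod (p ^ l)) ≀ᵣ G, (∀ x, (Φ x).right = ρ x) ∧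
      (∀ g ≠ 1, (Φ (FreeGroup.of i)).left g = 1) ∧
      (∀ j ≠ i, (Φ (FreeGroup.of j)).left = 1) ∧
      ∀ x, RegularWreathProduct.prodLeft (Φ x) =
        Multiplicative.ofAdd ((exponentSum i x).toAdd : ZMod (p ^ l)) := by
  classical
  let Φ : FreeGroup ι →* Multiplicative (ZMod (p ^ l)) ≀ᵣ G := FreeGroup.lift fun j =>
    ⟨if j = i then Pi.mulSingle 1 (Multiplicative.ofAdd 1) else 1, ρ (FreeGroup.of j)⟩
  refine ⟨Φ, fun x => ?_, fun g hg => by simp [Φ, hg], fun j hj => by simp [Φ, hj], fun x => ?_⟩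
  · have : RegularWreathProduct.rightHom.comp Φ = ρ := by ext j; simp [Φ]
    exact DFunLike.congr_fun this x
  · have : RegularWreathProduct.prodLeft.comp Φ =
        (AddMonoidHom.toMultiplicative (Int.castAddHom (ZMod (p ^ l)))).comp (exponentSum i) := by
      ext j
      by_cases hj : j = i
      · subst hj
        simp [Φ, RegularWreathProduct.prodLeft]
      · simp [Φ, RegularWreathProduct.prodLeft, hj, exponentSum_of_ne hj]
    exact DFunLike.congr_fun this x

theorem isConj_apply_of_isPGroup {p : ℕ} (hp : p.Prime) {α : MulAut (FreeGroup ι)}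
    (hα : ∀ N : Subgroup (FreeGroup ι), N.Normal → (∃ k : ℕ, N.index = p ^ k) →
      Subgroup.map α.toMonoidHom N = N)
    {i j : ι} (hij : i ≠ j) {f : FreeGroup ι}
    (hf : f = FreeGroup.of i ∨ f = FreeGroup.of i * FreeGroup.of j)
    {G : Type*} [Group G] [Finite G] (hG : IsPGroup p G) (ρ : FreeGroup ι →* G) :
    IsConj (ρ (α f)) (ρ f) := by
  have := Fact.mk hp
  obtain ⟨K, hK⟩ := hG.exists_card_eq
  have : NeZero (p ^ K) := ⟨pow_ne_zero _ hp.ne_zero⟩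
  have := Fintype.ofFinite G
  let σ : FreeGroup ι →* Multiplicative (ZMod (p ^ K)) :=
    (AddMonoidHom.toMultiplicative (Int.castAddHom (ZMod (p ^ K)))).comp (exponentSum i)
  have hsum : exponentSum i f = Multiplicative.ofAdd 1 ∧
      exponentSum i (α f) = Multiplicative.ofAdd 1 := by
    have h1 := exponentSum_apply_of_self hp hα hij
    have h2 := exponentSum_apply_eq_one hp hα (exponentSum_of_ne hij.symm)
    rcases hf with rfl | rfl
    · simp [h1]
    · simp [h1, h2, exponentSum_of_ne hij.symm]
  have hG' : IsPGroup p (G × Multiplicative (ZMod (p ^ K))) :=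
    IsPGroup.of_card (n := K + K) (by rw [Nat.card_prod, hK, pow_add]; simp)
  obtain ⟨g, m, hm⟩ := exists_conj_mem_zpowers hp hα hG' (ρ.prod σ) f fun l => by
    obtain ⟨Φ, h1, h2, h3, h4⟩ := exists_lift_regularWreathProduct p i (ρ.prod σ) l
    refine ⟨Φ, h1, fun g hg => ?_, ?_⟩
    · rcases hf with rfl | rfl
      · exact h2 g hg
      · simp [h2 g hg, h3 j hij.symm]
    · rw [h4, hsum.2]
      simp
  have h1 : ρ f ^ m = g.1⁻¹ * ρ (α f) * g.1 := congrArg Prod.fst hm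
  have h2 : σ f ^ m = g.2⁻¹ * σ (α f) * g.2 := congrArg Prod.snd hm
  have hσ (x) (hx : exponentSum i x = Multiplicative.ofAdd 1) :
      σ x = Multiplicative.ofAdd 1 := by simp [σ, hx]
  rw [inv_mul_cancel_comm, hσ _ hsum.1, hσ _ hsum.2, ← ofAdd_zsmul, zsmul_one] at h2
  have h3 : ((m - 1 : ℤ) : ZMod (p ^ K)) = 0 := by
    rw [Int.cast_sub, Int.cast_one, sub_eq_zero]
    exact Multiplicative.ofAdd.injective h2
  rw [ZMod.intCast_zmod_eq_zero_iff_dvd, ← hK] at h3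
  have h4 : ρ f ^ (m - 1) = 1 := by
    refine orderOf_dvd_iff_zpow_eq_one.1 (dvd_trans ?_ h3)
    exact_mod_cast _root_.orderOf_dvd_natCard _
  rw [zpow_sub_one, mul_inv_eq_one, h1] at h4
  exact isConj_iff.2 ⟨g.1⁻¹, by simpa using h4⟩

end Conjugacy

section Trace

open Polynomial

/-- `x` and `y` are conjugate in every finite `p`-group quotient of `F`. -/
def IsConjInPQuotients (p : ℕ) {F : Type*} [Group F] (x y : F) : Prop :=
  ∀ (N : Subgroup F) [N.Normal] [Finite (F ⧸ N)], IsPGroup p (F ⧸ N) →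
    IsConj (x : F ⧸ N) (y : F ⧸ N)

section CongruenceSubgroup

variable {F M : Type*} [Group F] [Ring M]

/-- The elements which are mapped to polynomials congruent to `1` modulo `X ^ k`. -/
def congruenceSubgroup (ρ : F →* M[X]ˣ) (k : ℕ) : Subgroup F where
  carrier := {x | (X : M[X]) ^ k ∣ (ρ x : M[X]) - 1}
  one_mem' := by simp
  mul_mem' {x y} hx hy := by
    have : ((ρ (x * y) : M[X]ˣ) : M[X]) - 1 = ((ρ x : M[X]) - 1) * ρ y + ((ρ y : M[X]) - 1) := by
      simp [sub_mul]
    rw [Set.mem_ofPred_eq, this]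
    exact dvd_add (Dvd.dvd.mul_right hx _) hy
  inv_mem' {x} hx := by
    have : ((ρ x⁻¹ : M[X]ˣ) : M[X]) - 1 = -(((ρ x : M[X]) - 1) * ((ρ x)⁻¹ : M[X]ˣ)) := by
      simp [sub_mul]
    rw [Set.mem_ofPred_eq, this, dvd_neg]
    exact Dvd.dvd.mul_right hx _

variable {ρ : F →* M[X]ˣ} {k : ℕ}

theorem mem_congruenceSubgroup {x : F} :
    x ∈ congruenceSubgroup ρ k ↔ (X : M[X]) ^ k ∣ (ρ x : M[X]) - 1 := Iff.rfl

theorem X_pow_dvd_mul_of_dvd {P : M[X]} (h : (X : M[X]) ^ k ∣ P) (Q : M[X]) :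
    (X : M[X]) ^ k ∣ Q * P := by
  obtain ⟨P, rfl⟩ := h
  rw [← mul_assoc, ← (commute_X_pow Q k).eq, mul_assoc]
  exact dvd_mul_right _ _

instance : (congruenceSubgroup ρ k).Normal where
  conj_mem x hx g := by
    have : ((ρ (g * x * g⁻¹) : M[X]ˣ) : M[X]) - 1 =
        ρ g * (((ρ x : M[X]) - 1) * ((ρ g)⁻¹ : M[X]ˣ)) := by
      simp [sub_mul, mul_sub, mul_assoc]
    rw [mem_congruenceSubgroup, this]
    exact X_pow_dvd_mul_of_dvd (Dvd.dvd.mul_right hx _) _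

theorem mk_eq_mk_iff_X_pow_dvd {x y : F} :
    (x : F ⧸ congruenceSubgroup ρ k) = y ↔ (X : M[X]) ^ k ∣ (ρ y : M[X]) - ρ x := by
  rw [QuotientGroup.eq, mem_congruenceSubgroup]
  constructor
  · intro h
    convert X_pow_dvd_mul_of_dvd h (ρ x) using 1
    simp [mul_sub]
  · intro h
    convert X_pow_dvd_mul_of_dvd h ((ρ x)⁻¹ : M[X]ˣ) using 1
    simp [mul_sub]

instance [Finite M] : Finite (F ⧸ congruenceSubgroup ρ k) := by
  refine Finite.of_injective (fun q (n : Fin k) => (ρ q.out : M[X]).coeff n) fun q q' h => ?_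
  rw [← q.out_eq', ← q'.out_eq']
  refine mk_eq_mk_iff_X_pow_dvd.2 (X_pow_dvd_iff.2 fun n hn => ?_)
  rw [coeff_sub, sub_eq_zero]
  exact (congrFun h ⟨n, hn⟩).symm

theorem isPGroup_quotient_congruenceSubgroup {p : ℕ} [Fact p.Prime] [CharP M p]
    (hρ : ∀ x, (ρ x : M[X]).coeff 0 = 1) : IsPGroup p (F ⧸ congruenceSubgroup ρ k) := by
  intro q
  obtain ⟨x, rfl⟩ := QuotientGroup.mk_surjective q
  refine ⟨k, ?_⟩
  rw [← QuotientGroup.mk_pow, QuotientGroup.eq_one_iff, mem_congruenceSubgroup, map_pow,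
    Units.val_pow_eq_pow_val]
  have h1 : (X : M[X]) ∣ (ρ x : M[X]) - 1 := by simp [X_dvd_iff, hρ]
  obtain ⟨B, hB⟩ := h1
  have h2 := sub_pow_char_pow_of_commute p k (Commute.one_right (ρ x : M[X]))
  rw [one_pow] at h2
  rw [← h2, hB, (commute_X B).mul_pow]
  exact Dvd.dvd.mul_right (pow_dvd_pow _ (Nat.lt_pow_self (Fact.out : p.Prime).one_lt).le) _

end CongruenceSubgroup

theorem trace_coeff_mul_comm {R n : Type*} [CommRing R] [Fintype n] [DecidableEq n]
    (P Q : (Matrix n n R)[X]) (k : ℕ) :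
    ((P * Q).coeff k).trace = ((Q * P).coeff k).trace := by
  rw [coeff_mul, coeff_mul, Matrix.trace_sum, Matrix.trace_sum,
    ← Finset.Nat.sum_antidiagonal_swap]
  exact Finset.sum_congr rfl fun _ _ => Matrix.trace_mul_comm _ _

theorem IsConjInPQuotients.trace_coeff_eq {p : ℕ} [Fact p.Prime] {F n : Type*} [Group F]
    [Fintype n] [DecidableEq n] [Nonempty n] (ρ : F →* (Matrix n n (ZMod p))[X]ˣ)
    (hρ : ∀ x, (ρ x : (Matrix n n (ZMod p))[X]).coeff 0 = 1) {x y : F}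
    (h : IsConjInPQuotients p x y) (k : ℕ) :
    ((ρ x : (Matrix n n (ZMod p))[X]).coeff k).trace =
      ((ρ y : (Matrix n n (ZMod p))[X]).coeff k).trace := by
  have := NeZero.mk (Fact.out : p.Prime).ne_zero
  have : Finite (Matrix n n (ZMod p)) := inferInstanceAs (Finite (n → n → ZMod p))
  obtain ⟨q, hq⟩ := isConj_iff.1
    (h (congruenceSubgroup ρ (k + 1)) (isPGroup_quotient_congruenceSubgroup hρ))
  obtain ⟨g, rfl⟩ := QuotientGroup.mk_surjective q
  rw [← QuotientGroup.mk_inv, ← QuotientGroup.mk_mul, ← QuotientGroup.mk_mul,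
    mk_eq_mk_iff_X_pow_dvd, X_pow_dvd_iff] at hq
  have h1 := hq k (Nat.lt_succ_self k)
  rw [coeff_sub, sub_eq_zero] at h1
  rw [h1, map_mul, Units.val_mul, trace_coeff_mul_comm, ← Units.val_mul, map_mul, map_inv,
    inv_mul_cancel_left]

section Representation

variable {ι : Type*} [DecidableEq ι] [Fintype ι] {R : Type*} [CommRing R]

/-- The matrix whose row `c` is `1` off the diagonal, all other entries being `0`. -/
def rowMatrix (R : Type*) [CommRing R] (c : ι × Bool) : Matrix (ι × Bool) (ι × Bool) R :=
  Matrix.vecMulVec (Pi.single c 1) (1 - Pi.single c 1)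

theorem vecMulVec_single_mul_vecMulVec_single (c d : ι × Bool) (v w : ι × Bool → R) :
    Matrix.vecMulVec (Pi.single c 1) v * Matrix.vecMulVec (Pi.single d 1) w =
      v d • Matrix.vecMulVec (Pi.single c 1) w := by
  simp [Matrix.vecMulVec_mul_vecMulVec, Matrix.vecMulVec_smul]

theorem rowMatrix_mul_self (c : ι × Bool) : rowMatrix R c * rowMatrix R c = 0 := by
  simp [rowMatrix, vecMulVec_single_mul_vecMulVec_single]

/-- The elementary factor `1 ± A X`, where `A` is the matrix `rowMatrix R c`. -/
noncomputable def rowFactor (R : Type*) [CommRing R] (b : Bool) (c : ι × Bool) :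
    (Matrix (ι × Bool) (ι × Bool) R)[X] :=
  1 + C (cond b 1 (-1) * rowMatrix R c) * X

theorem one_add_C_mul_X_mul_one_add_C_neg_mul_X {M : Type*} [Ring M] {A : M} (h : A * A = 0) :
    (1 + C A * X) * (1 + C (-A) * X) = 1 := by
  have h1 : C A * X * (C A * X) = 0 := by
    rw [mul_assoc, ← mul_assoc X, X_mul_C, mul_assoc, ← mul_assoc, ← C_mul, h, C_0, zero_mul]
  rw [C_neg, neg_mul, ← sub_eq_add_neg, mul_sub, mul_one, add_mul, h1]
  simp

theorem rowFactor_mul_rowFactor_not (b : Bool) (c : ι × Bool) :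
    rowFactor R b c * rowFactor R (!b) c = 1 := by
  have h := rowMatrix_mul_self (R := R) c
  unfold rowFactor
  cases b
  · have h1 := one_add_C_mul_X_mul_one_add_C_neg_mul_X (A := -rowMatrix R c)
      (by rw [neg_mul_neg, h])
    rw [neg_neg] at h1
    rwa [Bool.not_false, cond_false, cond_true, neg_one_mul, one_mul]
  · rw [Bool.not_true, cond_false, cond_true, neg_one_mul, one_mul]
    exact one_add_C_mul_X_mul_one_add_C_neg_mul_X h

/-- The image of a letter under the representation `traceRep`. -/
noncomputable def letterFactor (R : Type*) [CommRing R] (c : ι × Bool) :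
    (Matrix (ι × Bool) (ι × Bool) R)[X] :=
  rowFactor R c.2 c * rowFactor R c.2 (c.1, !c.2)

theorem letterFactor_mul_letterFactor_not (c : ι × Bool) :
    letterFactor R c * letterFactor R (c.1, !c.2) = 1 := by
  simp only [letterFactor, Bool.not_not]
  rw [mul_assoc, ← mul_assoc (rowFactor R c.2 (c.1, !c.2)), rowFactor_mul_rowFactor_not, one_mul,
    rowFactor_mul_rowFactor_not]

/-- A representation of the free group over `R[X]` for which the degree of the trace is twice the
cyclic length. -/
noncomputable def traceRep (ι R : Type*) [DecidableEq ι] [Fintype ι] [CommRing R] :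
    FreeGroup ι →* (Matrix (ι × Bool) (ι × Bool) R)[X]ˣ :=
  FreeGroup.lift fun i =>
    ⟨letterFactor R (i, true), letterFactor R (i, false),
      letterFactor_mul_letterFactor_not (i, true), letterFactor_mul_letterFactor_not (i, false)⟩

theorem traceRep_mk (L : List (ι × Bool)) :
    (traceRep ι R (FreeGroup.mk L) : (Matrix (ι × Bool) (ι × Bool) R)[X]) =
      (L.map (letterFactor R)).prod := by
  rw [traceRep, FreeGroup.lift_mk, ← Units.coeHom_apply, map_list_prod, List.map_map]
  congr 2
  ext1 ⟨i, b⟩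
  cases b <;> rfl

theorem coeff_zero_letterFactor (c : ι × Bool) : (letterFactor R c).coeff 0 = 1 := by
  simp [letterFactor, rowFactor, mul_coeff_zero]

theorem coeff_zero_traceRep (x : FreeGroup ι) :
    (traceRep ι R x : (Matrix (ι × Bool) (ι × Bool) R)[X]).coeff 0 = 1 := by
  obtain ⟨L, rfl⟩ := Quot.exists_rep x
  refine (congrArg (coeff · 0) (traceRep_mk L)).trans ?_
  induction L with
  | nil => simp
  | cons c L ih => simpa [mul_coeff_zero, coeff_zero_letterFactor] using ih

theorem natDegree_rowFactor_le (b : Bool) (c : ι × Bool) : (rowFactor R b c).natDegree ≤ 1 := by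
  unfold rowFactor
  compute_degree

theorem natDegree_letterFactor_le (c : ι × Bool) : (letterFactor R c).natDegree ≤ 2 :=
  natDegree_mul_le_of_le (natDegree_rowFactor_le _ _) (natDegree_rowFactor_le _ _)

theorem coeff_two_letterFactor (c : ι × Bool) : (letterFactor R c).coeff 2 =
    Matrix.vecMulVec (Pi.single c 1) (1 - Pi.single (c.1, !c.2) 1) := by
  have h1 (b : Bool) (c : ι × Bool) :
      (rowFactor R b c).coeff 1 = cond b 1 (-1) * rowMatrix R c := by
    simp [rowFactor, coeff_one]
  have h2 := coeff_mul_add_eq_of_natDegree_le (natDegree_rowFactor_le (R := R) c.2 c)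
    (natDegree_rowFactor_le (R := R) c.2 (c.1, !c.2))
  rw [letterFactor, h2, h1, h1]
  have h3 : ((c.1, !c.2) : ι × Bool) ≠ c := fun h => by simpa using congrArg Prod.snd h
  have h4 : rowMatrix R c * rowMatrix R (c.1, !c.2) =
      Matrix.vecMulVec (Pi.single c 1) (1 - Pi.single (c.1, !c.2) 1) := by
    simp [rowMatrix, vecMulVec_single_mul_vecMulVec_single, h3]
  rw [← h4]
  cases c.2 <;> simp

theorem prod_coeff_two_letterFactor {c : ι × Bool} {L : List (ι × Bool)}
    (h : FreeGroup.IsReduced (c :: L)) :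
    ((c :: L).map fun d => (letterFactor R d).coeff 2).prod =
      Matrix.vecMulVec (Pi.single c 1)
        (1 - Pi.single (((c :: L).getLast (by simp)).1, !((c :: L).getLast (by simp)).2) 1) := by
  induction L generalizing c with
  | nil => simp [coeff_two_letterFactor]
  | cons d L ih =>
    rw [List.map_cons, List.prod_cons, ih (h.infix ⟨[c], [], by simp⟩), coeff_two_letterFactor,
      vecMulVec_single_mul_vecMulVec_single, List.getLast_cons (List.cons_ne_nil d L)]
    have hne : d ≠ (c.1, !c.2) := by
      rintro rfl
      simp [FreeGroup.IsReduced] at h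
    simp only [Pi.sub_apply, Pi.one_apply, Pi.single_eq_of_ne hne, sub_zero, one_smul]

theorem trace_coeff_traceRep_mk {L : List (ι × Bool)} (h : FreeGroup.IsCyclicallyReduced L)
    (hL : L ≠ []) :
    ((traceRep ι R (FreeGroup.mk L) : (Matrix (ι × Bool) (ι × Bool) R)[X]).coeff
      (L.length * 2)).trace = 1 := by
  obtain ⟨c, L, rfl⟩ := List.exists_cons_of_ne_nil hL
  have h1 := coeff_list_prod_of_natDegree_le ((c :: L).map (letterFactor R)) 2 (by
    simp only [List.mem_map]
    rintro _ ⟨d, -, rfl⟩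
    exact natDegree_letterFactor_le d)
  rw [List.length_map, List.map_map] at h1
  rw [traceRep_mk, h1]
  refine (congrArg Matrix.trace (prod_coeff_two_letterFactor h.1)).trans ?_
  have hne : c ≠ (((c :: L).getLast (by simp)).1, !((c :: L).getLast (by simp)).2) := fun hc => by
    have h2 := h.2 _ (List.getLast_mem_getLast? (by simp)) c (by simp)
    have h3 := h2 (congrArg Prod.fst hc).symm
    have h4 := congrArg Prod.snd hc
    simp [h3] at h4
  simp [Matrix.trace_vecMulVec, hne]

theorem coeff_traceRep_mk_eq_zero {L : List (ι × Bool)} {k : ℕ} (h : L.length * 2 < k) :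
    (traceRep ι R (FreeGroup.mk L) : (Matrix (ι × Bool) (ι × Bool) R)[X]).coeff k = 0 := by
  refine coeff_eq_zero_of_natDegree_lt (lt_of_le_of_lt ?_ h)
  rw [traceRep_mk]
  refine (natDegree_list_prod_le _).trans ?_
  rw [List.map_map, ← List.length_map (as := L) (f := natDegree ∘ letterFactor R),
    ← smul_eq_mul]
  exact List.sum_le_card_nsmul _ _ fun n hn => by
    obtain ⟨c, -, rfl⟩ := List.mem_map.1 hn
    exact natDegree_letterFactor_le c

end Representation

/-- Cyclically reduced words which are conjugate in all finite `p`-group quotients have the same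
length. -/
theorem IsConjInPQuotients.length_eq {p : ℕ} (hp : p.Prime) {ι : Type*} [Fintype ι]
    {L M : List (ι × Bool)} (hL : FreeGroup.IsCyclicallyReduced L)
    (hM : FreeGroup.IsCyclicallyReduced M)
    (h : IsConjInPQuotients p (FreeGroup.mk L) (FreeGroup.mk M)) : L.length = M.length := by
  classical
  have := Fact.mk hp
  have key {L M : List (ι × Bool)} (hL : FreeGroup.IsCyclicallyReduced L)
      (h : ∀ n, ((traceRep ι (ZMod p) (FreeGroup.mk L)).val.coeff n).trace =
        ((traceRep ι (ZMod p) (FreeGroup.mk M)).val.coeff n).trace) : L.length ≤ M.length := by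
    by_contra! hlt
    have h1 := h (L.length * 2)
    rw [trace_coeff_traceRep_mk hL (by rintro rfl; simp at hlt),
      coeff_traceRep_mk_eq_zero (by omega), Matrix.trace_zero] at h1
    exact one_ne_zero h1
  rcases isEmpty_or_nonempty ι with hι | hι
  · rw [Subsingleton.elim L M]
  · have h1 := h.trace_coeff_eq (traceRep ι (ZMod p)) coeff_zero_traceRep
    exact le_antisymm (key hL h1) (key hM fun n => (h1 n).symm)

end Trace

section Words

variable {p : ℕ} {F : Type*} [Group F]

theorem IsConj.trans_isConjInPQuotients {x y z : F} (hxy : IsConj x y)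
    (hyz : IsConjInPQuotients p y z) : IsConjInPQuotients p x z := fun N _ _ hN =>
  ((QuotientGroup.mk' N).map_isConj hxy).trans (hyz N hN)

theorem mul_conj_of_commute_left {x y g h : F} (hc : Commute x h) :
    IsConj (x * (h * g * y * (h * g)⁻¹)) (x * (g * y * g⁻¹)) := by
  refine isConj_iff.2 ⟨h⁻¹, ?_⟩
  rw [← mul_assoc h⁻¹, ← hc.inv_right.eq]
  group

theorem mul_conj_of_commute_right {x y g h : F} (hc : Commute y h) :
    x * (g * h * y * (g * h)⁻¹) = x * (g * y * g⁻¹) := by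
  rw [mul_assoc g, ← hc.eq]
  group

theorem mk_singleton_mem_zpowers {ι : Type*} (c : ι × Bool) :
    FreeGroup.mk [c] ∈ zpowers (FreeGroup.of c.1) := by
  obtain ⟨i, b⟩ := c
  cases b
  · exact inv_mem (mem_zpowers (FreeGroup.of i))
  · exact mem_zpowers _

theorem mk_cons {ι : Type*} (c : ι × Bool) (L : List (ι × Bool)) :
    FreeGroup.mk (c :: L) = FreeGroup.mk [c] * FreeGroup.mk L := by
  rw [FreeGroup.mul_mk]
  rfl

variable {ι : Type*} [DecidableEq ι]

theorem isCyclicallyReduced_conj {i j : ι} (hij : i ≠ j) {w : List (ι × Bool)}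
    (hw : FreeGroup.IsReduced w) (hhead : ∀ c ∈ w.head?, c.1 ≠ i)
    (hlast : ∀ c ∈ w.getLast?, c.1 ≠ j) :
    FreeGroup.IsCyclicallyReduced ((i, true) :: (w ++ (j, true) :: FreeGroup.invRev w)) := by
  have hinv : FreeGroup.IsReduced (FreeGroup.invRev w) := by
    rw [FreeGroup.isReduced_iff_reduce_eq, FreeGroup.reduce_invRev, hw.reduce_eq]
  rcases w.eq_nil_or_concat' with rfl | ⟨u, d, hd⟩
  · simp [FreeGroup.IsCyclicallyReduced, FreeGroup.IsReduced, hij, hij.symm]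
  have hne : w ≠ [] := by simp [hd]
  have hdj : d.1 ≠ j := hlast d (by simp [hd])
  obtain ⟨c, v, rfl⟩ := List.exists_cons_of_ne_nil hne
  have hci : c.1 ≠ i := hhead c (by simp)
  have hlastInv : (FreeGroup.invRev (c :: v)).getLast? = some (c.1, !c.2) := by
    simp [FreeGroup.invRev]
  have hheadInv : (FreeGroup.invRev (c :: v)).head? = some (d.1, !d.2) := by
    rw [hd]
    simp [FreeGroup.invRev]
  have hheadLast : (c :: v).getLast? = some d := by simp [hd]
  refine ⟨?_, ?_⟩
  · rw [FreeGroup.IsReduced, List.isChain_cons, List.isChain_append, hheadLast]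
    exact ⟨by simp [hci.symm], hw, List.isChain_cons.2 ⟨by simp [hheadInv, hdj.symm], hinv⟩,
      by simp [hdj]⟩
  · rw [← List.cons_append, List.getLast?_append, List.getLast?_cons, hlastInv]
    simp [hci]

theorem exists_eq_zpow_mul_zpow [Fintype ι] (hp : p.Prime) {i j : ι} (hij : i ≠ j)
    (g : FreeGroup ι)
    (h : IsConjInPQuotients p (FreeGroup.of i * (g * FreeGroup.of j * g⁻¹))
      (FreeGroup.of i * FreeGroup.of j)) :
    ∃ a b : ℤ, g = FreeGroup.of i ^ a * FreeGroup.of j ^ b := by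
  obtain ⟨w, hw, rfl⟩ : ∃ w, FreeGroup.IsReduced w ∧ FreeGroup.mk w = g :=
    ⟨_, FreeGroup.isReduced_toWord, FreeGroup.mk_toWord⟩
  induction hn : w.length using Nat.strong_induction_on generalizing w with
  | _ n ih =>
  subst hn
  by_cases hhead : ∀ c ∈ w.head?, c.1 ≠ i
  · by_cases hlast : ∀ c ∈ w.getLast?, c.1 ≠ j
    · have h1 := IsConjInPQuotients.length_eq hp (M := [(i, true), (j, true)])
        (isCyclicallyReduced_conj hij hw hhead hlast)
        (by simp [FreeGroup.IsCyclicallyReduced, FreeGroup.IsReduced, hij, hij.symm]) (by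
          convert h using 1
          · rw [FreeGroup.inv_mk, mk_cons, ← FreeGroup.mul_mk, mk_cons (j, true)]
            simp only [mul_assoc]
            rfl
          · rfl)
      simp only [List.length_cons, List.length_append, FreeGroup.invRev_length, List.length_nil]
        at h1
      have h2 : w = [] := List.eq_nil_of_length_eq_zero (by omega)
      exact ⟨0, 0, by simp [h2, FreeGroup.one_eq_mk]⟩
    · push Not at hlast
      obtain ⟨c, hc, hcj⟩ := hlast
      rcases w.eq_nil_or_concat' with rfl | ⟨u, d, rfl⟩
      · simp at hc
      obtain rfl : d = c := by simpa using hc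
      obtain ⟨m, hm : FreeGroup.of j ^ m = _⟩ := hcj ▸ mk_singleton_mem_zpowers d
      rw [← FreeGroup.mul_mk, ← hm, mul_conj_of_commute_right ((Commute.refl _).zpow_right m)] at h
      obtain ⟨a, b, hab⟩ := ih u.length (by simp) u (hw.infix ⟨[], _, rfl⟩) h rfl
      exact ⟨a, b + m, by rw [← FreeGroup.mul_mk, hab, ← hm, zpow_add, mul_assoc]⟩
  · push Not at hhead
    obtain ⟨c, hc, hci⟩ := hhead
    obtain _ | ⟨d, u⟩ := w
    · simp at hc
    obtain rfl : d = c := by simpa using hc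
    obtain ⟨m, hm : FreeGroup.of i ^ m = _⟩ := hci ▸ mk_singleton_mem_zpowers d
    rw [mk_cons, ← hm] at h
    obtain ⟨a, b, hab⟩ := ih u.length (by simp) u (hw.infix ⟨[d], [], by simp⟩)
      ((mul_conj_of_commute_left ((Commute.refl _).zpow_right m)).symm.trans_isConjInPQuotients h)
      rfl
    exact ⟨m + a, b, by rw [mk_cons, hab, ← hm, zpow_add, mul_assoc]⟩

theorem exists_eq_conj_of_isConjInPQuotients_of [Fintype ι] (hp : p.Prime) {i : ι}
    {x : FreeGroup ι} (h : IsConjInPQuotients p x (FreeGroup.of i))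
    (hx : exponentSum i x = Multiplicative.ofAdd 1) : ∃ g, x = g * FreeGroup.of i * g⁻¹ := by
  have hconj := congrArg FreeGroup.mk
    (FreeGroup.reduceCyclically.conj_conjugator_reduceCyclically x.toWord)
  rw [FreeGroup.mk_toWord, ← FreeGroup.mul_mk, ← FreeGroup.mul_mk, ← FreeGroup.inv_mk] at hconj
  set g := FreeGroup.mk (FreeGroup.reduceCyclically.conjugator x.toWord)
  set L := FreeGroup.reduceCyclically x.toWord
  have hlen : L.length = 1 := IsConjInPQuotients.length_eq hp (M := [(i, true)])
    (FreeGroup.reduceCyclically.isCyclicallyReduced FreeGroup.isReduced_toWord) (by simp)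
    ((isConj_iff.2 ⟨g, hconj⟩).trans_isConjInPQuotients h)
  obtain ⟨⟨j, b⟩, hc⟩ := List.length_eq_one_iff.1 hlen
  refine ⟨g, ?_⟩
  rw [← hconj, hc] at hx ⊢
  rw [map_mul, map_mul, map_inv, mul_inv_cancel_comm] at hx
  have hj : j = i := by
    by_contra hne
    obtain ⟨m, hm⟩ := mk_singleton_mem_zpowers (j, b)
    rw [← hm] at hx
    rw [map_zpow, exponentSum_of_ne hne, one_zpow] at hx
    exact absurd hx (by decide)
  subst hj
  cases b
  · have h1 : exponentSum j (FreeGroup.of j)⁻¹ = Multiplicative.ofAdd 1 := hx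
    rw [map_inv, exponentSum_of_self, ← ofAdd_neg] at h1
    exact absurd (Multiplicative.ofAdd.injective h1) (by decide)
  · rfl

end Words

section Main

variable {ι : Type*} [DecidableEq ι]

/-- Automorphisms which map each generator `i` to a conjugate by `g i` are inner as soon as
all `(g i)⁻¹ * g j` are products of a power of the generator `i` and a power of the generator `j`. -/
theorem exists_forall_apply_eq_conj (α : MulAut (FreeGroup ι)) (g : ι → FreeGroup ι)
    (hα : ∀ i, α (FreeGroup.of i) = g i * FreeGroup.of i * (g i)⁻¹)
    (hg : ∀ i j, i ≠ j → ∃ a b : ℤ, (g i)⁻¹ * g j = FreeGroup.of i ^ a * FreeGroup.of j ^ b)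
    {i₀ i₁ : ι} (hne : i₀ ≠ i₁) :
    ∃ h : FreeGroup ι, ∀ x, α x = h * x * h⁻¹ := by
  obtain ⟨a, b, hab⟩ := hg i₀ i₁ hne
  set h := g i₀ * FreeGroup.of i₀ ^ a with hh
  have key (j : ι) : ∃ n : ℤ, g j = h * FreeGroup.of j ^ n := by
    by_cases h0 : j = i₀
    · exact ⟨-a, by simp [hh, h0]⟩
    by_cases h1 : j = i₁
    · exact ⟨b, by rw [hh, h1, mul_assoc, ← hab, mul_inv_cancel_left]⟩
    obtain ⟨a', b', hab'⟩ := hg i₀ j (Ne.symm h0)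
    obtain ⟨c, d, hcd⟩ := hg i₁ j (Ne.symm h1)
    have haa : a' = a := by
      have h2 : FreeGroup.of i₀ ^ a' * FreeGroup.of j ^ b' = FreeGroup.of i₀ ^ a *
          FreeGroup.of i₁ ^ b * (FreeGroup.of i₁ ^ c * FreeGroup.of j ^ d) := by
        rw [← hab', ← hab, ← hcd]
        group
      have h3 := congrArg (exponentSum i₀) h2
      simp only [map_mul, map_zpow, exponentSum_of_self, exponentSum_of_ne hne.symm,
        exponentSum_of_ne h0, one_zpow, mul_one, ← ofAdd_zsmul, smul_eq_mul] at h3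
      exact Multiplicative.ofAdd.injective h3
    exact ⟨b', by rw [hh, mul_assoc, ← haa, ← hab', mul_inv_cancel_left]⟩
  refine ⟨h, fun x => ?_⟩
  have heq : α.toMonoidHom = (MulAut.conj h).toMonoidHom := by
    ext j
    obtain ⟨n, hn⟩ := key j
    change α (FreeGroup.of j) = h * FreeGroup.of j * h⁻¹
    rw [hα, hn, mul_inv_rev, mul_assoc h, ← ((Commute.refl _).zpow_right n).eq]
    group
  exact DFunLike.congr_fun heq x

end Main

/-- If an automorphism of a free group `F_r` (`r ≥ 2`) preserves every normal
subgroup of `p`-power index, then it is an inner automorphism. -/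
theorem auto_preserving_p_power_normal_subgroups_is_inner
    (p : ℕ) (hp : p.Prime) (r : ℕ) (hr : 2 ≤ r)
    (α : MulAut (FreeGroup (Fin r)))
    (hα : ∀ N : Subgroup (FreeGroup (Fin r)), N.Normal → (∃ k : ℕ, N.index = p ^ k) →
      Subgroup.map α.toMonoidHom N = N) :
    ∃ g : FreeGroup (Fin r), ∀ x, α x = g⁻¹ * x * g := by
  have := Fin.nontrivial_iff_two_le.2 hr
  have hconj {i j : Fin r} (hij : i ≠ j) {f : FreeGroup (Fin r)}
      (hf : f = FreeGroup.of i ∨ f = FreeGroup.of i * FreeGroup.of j) :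
      IsConjInPQuotients p (α f) f := fun N _ _ hN =>
    isConj_apply_of_isPGroup hp hα hij hf hN (QuotientGroup.mk' N)
  have hgen (i : Fin r) :
      ∃ g, α (FreeGroup.of i) = g * FreeGroup.of i * g⁻¹ := by
    obtain ⟨j, hij⟩ := exists_ne i
    exact exists_eq_conj_of_isConjInPQuotients_of hp (hconj hij.symm (Or.inl rfl))
      (exponentSum_apply_of_self hp hα hij.symm)
  choose g hg using hgen
  have hprod (i j : Fin r) (hij : i ≠ j) :
      ∃ a b : ℤ, (g i)⁻¹ * g j = FreeGroup.of i ^ a * FreeGroup.of j ^ b := by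
    refine exists_eq_zpow_mul_zpow hp hij _
      (IsConj.trans_isConjInPQuotients ?_ (hconj hij (Or.inr rfl)))
    refine isConj_iff.2 ⟨g i, ?_⟩
    rw [map_mul, hg, hg]
    group
  obtain ⟨i₀, i₁, hne⟩ := exists_pair_ne (Fin r)
  obtain ⟨h, hh⟩ := exists_forall_apply_eq_conj α g hg hprod hne
  exact ⟨h⁻¹, fun x => by rw [hh, inv_inv]⟩
end

section
/- Let r ≥ 2 and let F = F_r be the free group on r generators. For every n ≥ 1, the number a_n(F) of subgroups of F of index exactly n satisfies (n!)^{r−1} ≤ a_n(F) ≤ n·(n!)^{r−1}. -/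
open Equiv

/-- The subgroup of elements fixing the point `x` under a permutation representation. -/
def pointStabilizer {G X : Type*} [Group G] (φ : G →* Perm X) (x : X) : Subgroup G :=
  (MulAction.stabilizer (Perm X) x).comap φ

theorem mem_pointStabilizer {G X : Type*} [Group G] {φ : G →* Perm X} {x : X} {g : G} :
    g ∈ pointStabilizer φ x ↔ φ g x = x := Iff.rfl

theorem index_pointStabilizer {G X : Type*} [Group G] {φ : G →* Perm X} {x : X}
    (h : ∀ y, ∃ g, φ g x = y) : (pointStabilizer φ x).index = Nat.card X := by
  let : MulAction G X := MulAction.compHom X φ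
  have key : pointStabilizer φ x = MulAction.stabilizer G x := rfl
  rw [key, MulAction.index_stabilizer,
    show MulAction.orbit G x = Set.univ from Set.eq_univ_of_forall h, Set.ncard_univ]

/-- If a fixed element acts by the same transitive permutation in two permutation
representations, then the representations agree as soon as their point stabilizers do. -/
theorem eq_of_pointStabilizer_eq {G X : Type*} [Group G] {φ ψ : G →* Perm X} {x : X} {t : G}
    (ht : φ t = ψ t) (htrans : ∀ y, ∃ k : ℕ, (φ t ^ k) x = y)
    (h : pointStabilizer φ x = pointStabilizer ψ x) : φ = ψ := by
  have base (w : G) : φ w x = ψ w x := by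
    obtain ⟨k, hk⟩ := htrans (φ w x)
    have mem : (t ^ k)⁻¹ * w ∈ pointStabilizer φ x := by
      rw [mem_pointStabilizer, map_mul, map_inv, map_pow, Perm.mul_apply, Perm.inv_eq_iff_eq, hk]
    rw [h, mem_pointStabilizer, map_mul, map_inv, map_pow, Perm.mul_apply, Perm.inv_eq_iff_eq,
      ← ht, hk] at mem
    exact mem.symm
  ext w y
  obtain ⟨k, rfl⟩ := htrans y
  have := base (w * t ^ k)
  rwa [map_mul, map_mul, map_pow, map_pow, ← ht] at this

theorem addRight_one_pow_apply (n k : ℕ) (x : ZMod n) :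
    ((Equiv.addRight (1 : ZMod n)) ^ k) x = x + k := by
  induction k with
  | zero => simp
  | succ k ih => rw [pow_succ', Perm.mul_apply, ih]; simp [add_assoc]

/-- The permutation representation on `X` obtained by labelling the cosets of `H`. -/
def cosetRepresentation {G X : Type*} [Group G] {H : Subgroup G} (e : G ⧸ H ≃ X) : G →* Perm X :=
  e.permCongrHom.toMonoidHom.comp (MulAction.toPermHom G (G ⧸ H))

theorem cosetRepresentation_apply {G X : Type*} [Group G] {H : Subgroup G} (e : G ⧸ H ≃ X)
    (g : G) : cosetRepresentation e g (e (1 : G)) = e (g : G ⧸ H) := by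
  simp [cosetRepresentation, Equiv.permCongrHom]

theorem pointStabilizer_cosetRepresentation {G X : Type*} [Group G] {H : Subgroup G}
    (e : G ⧸ H ≃ X) : pointStabilizer (cosetRepresentation e) (e (1 : G)) = H := by
  ext g
  rw [mem_pointStabilizer, cosetRepresentation_apply, e.apply_eq_iff_eq, eq_comm, QuotientGroup.eq]
  simp

/-- A subgroup of index `n` together with a labelling of its cosets is determined by the
resulting permutation representation and the label of the trivial coset. -/
theorem exists_injective_index_prod_perm (G : Type*) [Group G] (n : ℕ) [NeZero n] :
    ∃ F : {H : Subgroup G // H.index = n} × Perm (Fin n) → (G →* Perm (Fin n)) × Fin n,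
      Function.Injective F := by
  have label (H : {H : Subgroup G // H.index = n}) : Nonempty (G ⧸ H.1 ≃ Fin n) := by
    have hc : Nat.card (G ⧸ H.1) = n := H.2
    have : Finite (G ⧸ H.1) := Nat.finite_of_card_ne_zero (by rw [hc]; exact NeZero.ne n)
    exact ⟨Finite.equivFinOfCardEq hc⟩
  let e H := (label H).some
  refine ⟨fun p => (cosetRepresentation ((e p.1).trans p.2),
    (e p.1).trans p.2 ((1 : G) : G ⧸ p.1.1)), ?_⟩
  rintro ⟨H, σ⟩ ⟨K, τ⟩ h
  obtain ⟨h₁, h₂⟩ := Prod.mk.inj h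
  dsimp only at h₁ h₂
  have hHK : H = K := by
    apply Subtype.ext
    rw [← pointStabilizer_cosetRepresentation ((e H).trans σ), h₁, h₂,
      pointStabilizer_cosetRepresentation]
  subst hHK
  congr 1
  ext i
  obtain ⟨q, rfl⟩ := (e H).surjective i
  obtain ⟨g, rfl⟩ := QuotientGroup.mk_surjective q
  have h₃ := cosetRepresentation_apply ((e H).trans σ) g
  rw [h₁, h₂, cosetRepresentation_apply] at h₃
  exact congrArg Fin.val h₃.symm

/-- The number of subgroups of index exactly `n` in the free group on `r ≥ 2`
generators lies between `(n!)^(r-1)` and `n * (n!)^(r-1)`. -/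
theorem subgroup_growth_of_free_group (r : ℕ) (hr : 2 ≤ r) (n : ℕ) (hn : 1 ≤ n) :
    (n.factorial) ^ (r - 1) ≤
        Nat.card {H : Subgroup (FreeGroup (Fin r)) // H.index = n} ∧
      Nat.card {H : Subgroup (FreeGroup (Fin r)) // H.index = n} ≤
        n * (n.factorial) ^ (r - 1) := by
  obtain ⟨s, rfl⟩ : ∃ s, r = s + 1 := ⟨r - 1, by omega⟩
  have : NeZero n := ⟨by omega⟩
  rw [Nat.add_sub_cancel]
  obtain ⟨F, hF⟩ := exists_injective_index_prod_perm (FreeGroup (Fin (s + 1))) n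
  have : Finite (FreeGroup (Fin (s + 1)) →* Perm (Fin n)) :=
    Finite.of_equiv _ FreeGroup.lift
  have hfin : Finite {H : Subgroup (FreeGroup (Fin (s + 1))) // H.index = n} :=
    Finite.of_injective (fun H => F (H, 1)) fun H K h => congrArg Prod.fst (hF h)
  constructor
  · let φ (g : Fin s → Perm (ZMod n)) : FreeGroup (Fin (s + 1)) →* Perm (ZMod n) :=
      FreeGroup.lift (Fin.cons (Equiv.addRight 1) g)
    have hφ (g) : φ g (FreeGroup.of 0) = Equiv.addRight 1 := by simp [φ]
    have htrans (g) (y : ZMod n) : ∃ k : ℕ, (φ g (FreeGroup.of 0) ^ k) 0 = y :=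
      ⟨y.val, by rw [hφ, addRight_one_pow_apply, zero_add, ZMod.natCast_zmod_val]⟩
    have hindex (g) : (pointStabilizer (φ g) 0).index = n := by
      rw [index_pointStabilizer, Nat.card_zmod]
      intro y
      obtain ⟨k, hk⟩ := htrans g y
      exact ⟨FreeGroup.of 0 ^ k, by rwa [map_pow]⟩
    have hinj : Function.Injective fun g =>
        (⟨pointStabilizer (φ g) 0, hindex g⟩ :
          {H : Subgroup (FreeGroup (Fin (s + 1))) // H.index = n}) := by
      intro g g' h
      have hgg' : φ g = φ g' :=
        eq_of_pointStabilizer_eq ((hφ g).trans (hφ g').symm) (htrans g) (congrArg Subtype.val h)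
      exact Fin.cons_right_injective (α := fun _ => Perm (ZMod n)) _
        (FreeGroup.lift.injective hgg')
    simpa only [Nat.card_fun, Nat.card_perm, Nat.card_zmod, Nat.card_fin] using
      Nat.card_le_card_of_injective _ hinj
  · have h := Nat.card_le_card_of_injective F hF
    rw [Nat.card_prod, Nat.card_prod, ← Nat.card_congr FreeGroup.lift, Nat.card_fun,
      Nat.card_perm, Nat.card_fin, Nat.card_fin, pow_succ] at h
    exact Nat.le_of_mul_le_mul_right (by linarith) n.factorial_pos
end

section
/- Let Q be a finite group with |Q| ≥ 3 and let T ≤ Q be a subgroup such that the only normal subgroup of Q contained in T is the trivial subgroup. Let R = Q *_T Q be the free product of two copies of Q amalgamated along T (via the inclusion maps), let π̄ : R → Q be the natural projection which is the identity on each copy of Q, and let F = ker(π̄). Then F is a free group of rank at least 2; in particular F is a non-abelian free group. -/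
namespace AmalgamKernel

open Monoid

variable {Q : Type*} [Group Q] (T : Subgroup Q)

/-- The free group on the nontrivial left cosets of `T`. -/
abbrev CosetFreeGroup : Type _ := FreeGroup {c : Q ⧸ T // c ≠ ((1 : Q) : Q ⧸ T)}

open Classical in
/-- The generator attached to a left coset, with the trivial coset sent to `1`. -/
noncomputable def gen (c : Q ⧸ T) : CosetFreeGroup T :=
  if h : c = ((1 : Q) : Q ⧸ T) then 1 else FreeGroup.of ⟨c, h⟩

variable {T}

@[simp]
theorem gen_one : gen T ((1 : Q) : Q ⧸ T) = 1 := by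
  simp [gen]

theorem gen_coe (c : {c : Q ⧸ T // c ≠ ((1 : Q) : Q ⧸ T)}) : gen T c = FreeGroup.of c := by
  simp [gen, c.2]

theorem gen_mem {t : Q} (ht : t ∈ T) : gen T (t : Q ⧸ T) = 1 := by
  rw [← gen_one, QuotientGroup.eq.2 (by simpa using ht : t⁻¹ * 1 ∈ T)]

/-- Homomorphisms out of `CosetFreeGroup T` are determined by the elements `gen T c`. -/
theorem hom_ext_gen {M : Type*} [Monoid M] {f g : CosetFreeGroup T →* M}
    (h : ∀ c, f (gen T c) = g (gen T c)) : f = g :=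
  FreeGroup.ext_hom _ _ fun c => by simpa only [gen_coe] using h c

/-- The homomorphism out of `CosetFreeGroup T` extending a function on cosets. -/
def cosetLift {M : Type*} [Group M] (f : Q ⧸ T → M) : CosetFreeGroup T →* M :=
  FreeGroup.lift fun c => f c

theorem cosetLift_gen {M : Type*} [Group M] {f : Q ⧸ T → M} (hf : f ((1 : Q) : Q ⧸ T) = 1)
    (c : Q ⧸ T) : cosetLift f (gen T c) = f c := by
  by_cases h : c = ((1 : Q) : Q ⧸ T)
  · rw [h, gen_one, map_one, hf]
  · rw [gen_coe ⟨c, h⟩, cosetLift, FreeGroup.lift_apply_of]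

/-- The endomorphism of `CosetFreeGroup T` given by the twisted translation
`gen c ↦ (gen g)⁻¹ * gen (g • c)`. -/
noncomputable def twist (g : Q) : CosetFreeGroup T →* CosetFreeGroup T :=
  cosetLift fun c => (gen T (g : Q ⧸ T))⁻¹ * gen T (g • c)

theorem twist_gen (g : Q) (c : Q ⧸ T) :
    twist g (gen T c) = (gen T (g : Q ⧸ T))⁻¹ * gen T (g • c) :=
  cosetLift_gen (by simp) c

variable (T) in
theorem twist_one : twist (T := T) (1 : Q) = MonoidHom.id _ :=
  hom_ext_gen fun c => by simp [twist_gen]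

theorem twist_comp (g h : Q) : (twist g).comp (twist (T := T) h) = twist (g * h) :=
  hom_ext_gen fun c => by
    simp [twist_gen, mul_smul]

variable (T) in
/-- The action of `Q` on `CosetFreeGroup T` by twisted translations. -/
noncomputable def twistHom : Q →* MulAut (CosetFreeGroup T) where
  toFun g := MonoidHom.toMulEquiv (twist g) (twist g⁻¹)
    (by rw [twist_comp, inv_mul_cancel, twist_one])
    (by rw [twist_comp, mul_inv_cancel, twist_one])
  map_one' := by
    ext1 x
    exact DFunLike.congr_fun (twist_one T) x
  map_mul' g h := by
    ext1 x
    exact (DFunLike.congr_fun (twist_comp g h) x).symm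

theorem twistHom_apply (g : Q) (x : CosetFreeGroup T) : twistHom T g x = twist g x := rfl

variable (T) in
/-- The section `q ↦ (gen q, q)` of the projection of the semidirect product onto `Q`. -/
noncomputable def genSection : Q →* CosetFreeGroup T ⋊[twistHom T] Q where
  toFun q := ⟨gen T (q : Q ⧸ T), q⟩
  map_one' := by ext1 <;> simp
  map_mul' g h := by
    ext1 <;> simp [twistHom_apply, twist_gen]

/-- The amalgamated free product `Q *_T Q`. -/
abbrev Double (T : Subgroup Q) : Type _ := PushoutI fun _ : Bool => T.subtype

variable (T) in
/-- The folding map `Q *_T Q → Q`. -/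
abbrev fold : Double T →* Q :=
  PushoutI.lift (φ := fun _ : Bool => T.subtype)
    (fun _ => MonoidHom.id Q) T.subtype (fun _ => MonoidHom.id_comp _)

/-- One of the two inclusions `Q → Q *_T Q`. -/
abbrev incl (T : Subgroup Q) (b : Bool) : Q →* Double T :=
  PushoutI.of (G := fun _ : Bool => Q) b

theorem incl_mem {t : Q} (ht : t ∈ T) (b b' : Bool) : incl T b t = incl T b' t :=
  (PushoutI.of_apply_eq_base (fun _ : Bool => T.subtype) b ⟨t, ht⟩).trans
    (PushoutI.of_apply_eq_base (fun _ : Bool => T.subtype) b' ⟨t, ht⟩).symm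

variable (T) in
/-- The map `Q *_T Q → CosetFreeGroup T ⋊ Q` induced by the sections `q ↦ (gen q, q)` and
`q ↦ (1, q)`. -/
noncomputable def toSemidirect : Double T →* CosetFreeGroup T ⋊[twistHom T] Q :=
  PushoutI.lift (fun b => cond b (genSection T) SemidirectProduct.inr)
    (SemidirectProduct.inr.comp T.subtype) (by
      rintro (_ | _)
      · rfl
      · ext1 t
        ext1
        · exact gen_mem t.2
        · rfl)

theorem toSemidirect_true (q : Q) : toSemidirect T (incl T true q) = genSection T q :=
  PushoutI.lift_of ..

theorem toSemidirect_false (q : Q) :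
    toSemidirect T (incl T false q) = SemidirectProduct.inr q :=
  PushoutI.lift_of ..

variable (T) in
/-- The element of `Q *_T Q` comparing the two copies of a representative of a coset. -/
def diff (c : Q ⧸ T) : Double T :=
  Quotient.liftOn' c (fun q => incl T true q * (incl T false q)⁻¹) fun a b hab => by
    have h := incl_mem (QuotientGroup.leftRel_apply.1 hab) true false
    rw [map_mul, map_mul, map_inv, map_inv, inv_mul_eq_iff_eq_mul, ← mul_assoc] at h
    rw [h, mul_inv_cancel_right]

theorem diff_coe (q : Q) : diff T (q : Q ⧸ T) = incl T true q * (incl T false q)⁻¹ := rfl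

theorem diff_one : diff T ((1 : Q) : Q ⧸ T) = 1 := by
  rw [diff_coe, map_one, map_one, inv_one, mul_one]

variable (T) in
/-- The homomorphism from the free group to `Q *_T Q` with image the kernel of `fold T`. -/
def ofFree : CosetFreeGroup T →* Double T :=
  cosetLift (diff T)

theorem ofFree_gen (c : Q ⧸ T) : ofFree T (gen T c) = diff T c :=
  cosetLift_gen diff_one c

theorem toSemidirect_ofFree :
    (toSemidirect T).comp (ofFree T) = SemidirectProduct.inl :=
  hom_ext_gen fun c => by
    induction c using QuotientGroup.induction_on with
    | H q =>
      rw [MonoidHom.comp_apply, ofFree_gen, diff_coe, map_mul, map_inv, toSemidirect_true,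
        toSemidirect_false, mul_inv_eq_iff_eq_mul]
      exact SemidirectProduct.mk_eq_inl_mul_inr ..

theorem ofFree_injective : Function.Injective (ofFree T) := by
  refine Function.Injective.of_comp (f := toSemidirect T) ?_
  rw [← MonoidHom.coe_comp, toSemidirect_ofFree]
  exact SemidirectProduct.inl_injective

theorem ofFree_twist (g : Q) (x : CosetFreeGroup T) :
    ofFree T (twist g x) = incl T false g * ofFree T x * (incl T false g)⁻¹ := by
  suffices h : (ofFree T).comp (twist g) =
      (MulAut.conj (incl T false g)).toMonoidHom.comp (ofFree T) from DFunLike.congr_fun h x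
  refine hom_ext_gen fun c => ?_
  induction c using QuotientGroup.induction_on with
  | H q =>
    simp only [MonoidHom.comp_apply, twist_gen, map_mul, map_inv, ofFree_gen,
      MulAction.Quotient.smul_coe, smul_eq_mul, MulEquiv.coe_toMonoidHom, MulAut.conj_apply,
      diff_coe]
    group

variable (T) in
/-- The inverse of `toSemidirect T`. -/
noncomputable def ofSemidirect : CosetFreeGroup T ⋊[twistHom T] Q →* Double T :=
  SemidirectProduct.lift (ofFree T) (incl T false) fun g => by
    ext1 x
    exact ofFree_twist g _

theorem ofSemidirect_toSemidirect (r : Double T) : ofSemidirect T (toSemidirect T r) = r := by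
  suffices h : (ofSemidirect T).comp (toSemidirect T) = MonoidHom.id _ from
    DFunLike.congr_fun h r
  refine PushoutI.hom_ext_nonempty fun b => ?_
  ext1 q
  cases b
  · change ofSemidirect T (toSemidirect T (incl T false q)) = incl T false q
    rw [toSemidirect_false]
    exact SemidirectProduct.lift_inr ..
  · change ofSemidirect T (toSemidirect T (incl T true q)) = incl T true q
    rw [toSemidirect_true]
    change ofFree T (gen T q) * incl T false q = _
    rw [ofFree_gen, diff_coe, inv_mul_cancel_right]

theorem fold_incl (b : Bool) (q : Q) : fold T (incl T b q) = q :=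
  PushoutI.lift_of ..

theorem fold_ofFree (x : CosetFreeGroup T) : fold T (ofFree T x) = 1 := by
  suffices h : (fold T).comp (ofFree T) = 1 from DFunLike.congr_fun h x
  refine hom_ext_gen fun c => ?_
  induction c using QuotientGroup.induction_on with
  | H q =>
    rw [MonoidHom.comp_apply, ofFree_gen, diff_coe, map_mul, map_inv, fold_incl, fold_incl,
      mul_inv_cancel, MonoidHom.one_apply]

theorem range_ofFree : (ofFree T).range = (fold T).ker := by
  refine le_antisymm ?_ fun r hr => ?_
  · rintro _ ⟨x, rfl⟩
    exact fold_ofFree x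
  · have h : ofFree T (toSemidirect T r).left * incl T false (toSemidirect T r).right = r :=
      ofSemidirect_toSemidirect r
    have hright : (toSemidirect T r).right = 1 := by
      rw [MonoidHom.mem_ker, ← h, map_mul, fold_ofFree, fold_incl, one_mul] at hr
      exact hr
    exact ⟨(toSemidirect T r).left, by rwa [hright, map_one, mul_one] at h⟩

variable (T) in
/-- The kernel of the folding map `Q *_T Q → Q` is free on the nontrivial left cosets of `T`. -/
noncomputable def kerFoldEquiv : (fold T).ker ≃* CosetFreeGroup T :=
  ((MonoidHom.ofInjective ofFree_injective).trans
    (MulEquiv.subgroupCongr range_ofFree)).symm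

/-- A subgroup containing no nontrivial normal subgroup of a finite group of order at least `3`
has index at least `3`. -/
theorem three_le_index [Finite Q] (hQ : 3 ≤ Nat.card Q)
    (hT : ∀ N : Subgroup Q, N.Normal → N ≤ T → N = ⊥) : 3 ≤ T.index := by
  by_contra! hlt
  have h0 : T.index ≠ 0 := Subgroup.index_ne_zero_of_finite
  have hnormal : T.Normal := by
    obtain h | h : T.index = 1 ∨ T.index = 2 := by omega
    · rw [Subgroup.index_eq_one.1 h]
      infer_instance
    · exact Subgroup.normal_of_index_eq_two h
  rw [hT T hnormal le_rfl, Subgroup.index_bot] at hlt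
  omega

end AmalgamKernel


/-- Let `Q` be a finite group of order at least `3` and `T ≤ Q` a subgroup containing
no non-trivial normal subgroup of `Q`.  Let `R = Q *_T Q` be the amalgamated free
product of two copies of `Q` along `T` (realized as the pushout of the two inclusion
maps `T ↪ Q`), and let `π̄ : R → Q` be the natural projection restricting to the
identity on each copy of `Q`.  Then `F = ker π̄` is a free group of rank at least `2`;
in particular it is a non-abelian free group. -/
theorem kernel_of_amalgam_projection_is_free
    (Q : Type*) [Group Q] [Finite Q] (hQ : 3 ≤ Nat.card Q)
    (T : Subgroup Q) (hT : ∀ N : Subgroup Q, N.Normal → N ≤ T → N = ⊥) :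
    ∃ m : ℕ, 2 ≤ m ∧
      Nonempty
        ((Monoid.PushoutI.lift (φ := fun _ : Bool => T.subtype)
            (fun _ => MonoidHom.id Q) T.subtype
            (fun _ => MonoidHom.id_comp _)).ker ≃* FreeGroup (Fin m)) := by
  have hindex := AmalgamKernel.three_le_index hQ hT
  have hcard : Nat.card {c : Q ⧸ T // c ≠ ((1 : Q) : Q ⧸ T)} + 1 = T.index := by
    have := Set.ncard_add_ncard_compl {((1 : Q) : Q ⧸ T)}
    rw [Set.ncard_singleton, add_comm] at this
    exact this
  exact ⟨_, by omega, ⟨(AmalgamKernel.kerFoldEquiv T).trans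
    (FreeGroup.freeGroupCongr (Finite.equivFin _))⟩⟩
end

section
/- Let Q be a finite group with |Q| ≥ 3 and let T ≤ Q be a subgroup such that the only normal subgroup of Q contained in T is the trivial subgroup. Let R = Q *_T Q be the free product of two copies of Q amalgamated along T (via the inclusion maps), let π̄ : R → Q be the natural projection which is the identity on each copy of Q, and let F = ker(π̄). Then the centralizer of F in R is trivial: C_R(F) = {e}. -/
namespace Monoid.PushoutI

section Reduced

variable {ι : Type*} {G : ι → Type*} {H : Type*} [∀ i, Group (G i)] [Group H]

/-- `IsReducedProd φ i j r` says that `r` is the product of a nonempty reduced word of the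
amalgamated product whose first letter lies in `G i` and whose last letter lies in `G j`. -/
inductive IsReducedProd (φ : ∀ i, H →* G i) : ι → ι → PushoutI φ → Prop
  | of {i : ι} {g : G i} (hg : g ∉ (φ i).range) : IsReducedProd φ i i (PushoutI.of i g)
  | mul {i j k l : ι} {r s : PushoutI φ} (hr : IsReducedProd φ i j r) (hjk : j ≠ k)
      (hs : IsReducedProd φ k l s) : IsReducedProd φ i l (r * s)

namespace IsReducedProd

variable {φ : ∀ i, H →* G i} {i j : ι} {r : PushoutI φ}

theorem inv (h : IsReducedProd φ i j r) : IsReducedProd φ j i r⁻¹ := by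
  induction h with
  | of hg => rw [← map_inv]; exact .of (by simpa using hg)
  | mul _ hjk _ ihr ihs => rw [mul_inv_rev]; exact ihs.mul hjk.symm ihr

theorem exists_neWord (h : IsReducedProd φ i j r) :
    ∃ w : CoprodI.NeWord G i j, Reduced φ w.toWord ∧ ofCoprodI w.prod = r := by
  induction h with
  | @of i g hg =>
    refine ⟨.singleton g (fun h => hg (h ▸ one_mem _)), ?_, by simp⟩
    intro p hp
    obtain rfl : p = ⟨i, g⟩ := by simpa [CoprodI.NeWord.toWord] using hp
    exact hg
  | mul _ hjk _ ihr ihs =>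
    obtain ⟨u, hu, rfl⟩ := ihr
    obtain ⟨v, hv, rfl⟩ := ihs
    refine ⟨u.append hjk v, ?_, by simp⟩
    intro p hp
    rcases List.mem_append.1 hp with hp | hp
    exacts [hu p hp, hv p hp]

theorem notMem_range_base (hφ : ∀ i, Function.Injective (φ i)) (h : IsReducedProd φ i j r) :
    r ∉ (base φ).range := by
  obtain ⟨w, hw, rfl⟩ := h.exists_neWord
  intro hr
  have := hw.eq_empty_of_mem_range hφ (by simpa [CoprodI.NeWord.prod] using hr)
  exact w.toList_ne_nil (congrArg CoprodI.Word.toList this)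

theorem exists_head (h : IsReducedProd φ i j r) :
    ∃ g ∉ (φ i).range, ∀ q, q * g ∉ (φ i).range → IsReducedProd φ i j (PushoutI.of i q * r) := by
  induction h with
  | @of i g hg => exact ⟨g, hg, fun q hq => by rw [← map_mul]; exact .of hq⟩
  | mul _ hjk hs ihr _ =>
    obtain ⟨g, hg, hq⟩ := ihr
    exact ⟨g, hg, fun q h => by rw [← mul_assoc]; exact (hq q h).mul hjk hs⟩

theorem base_mul (h : IsReducedProd φ i j r) (t : H) : IsReducedProd φ i j (base φ t * r) := by
  obtain ⟨g, hg, hq⟩ := h.exists_head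
  rw [← of_apply_eq_base φ i]
  exact hq _ (by rwa [Subgroup.mul_mem_cancel_left _ (MonoidHom.mem_range.2 ⟨t, rfl⟩)])

theorem of_mul_same (h : IsReducedProd φ i j r) (q : G i) :
    PushoutI.of i q * r ∈ (base φ).range ∨ ∃ k, IsReducedProd φ k j (PushoutI.of i q * r) := by
  induction h with
  | @of i g hg =>
    rw [← map_mul]
    by_cases hq : q * g ∈ (φ i).range
    · obtain ⟨t, ht⟩ := hq
      exact .inl ⟨t, by rw [← ht, of_apply_eq_base]⟩
    · exact .inr ⟨i, .of hq⟩
  | @mul _ _ k _ _ _ _ hjk hs ihr _ =>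
    rw [← mul_assoc]
    rcases ihr q with ⟨t, ht⟩ | ⟨m, hm⟩
    · exact .inr ⟨k, ht ▸ hs.base_mul t⟩
    · exact .inr ⟨m, hm.mul hjk hs⟩

theorem of_mul (h : IsReducedProd φ i j r) {k : ι} (q : G k) :
    PushoutI.of k q * r ∈ (base φ).range ∨ ∃ m, IsReducedProd φ m j (PushoutI.of k q * r) := by
  by_cases hki : k = i
  · subst hki
    exact h.of_mul_same q
  by_cases hq : q ∈ (φ k).range
  · obtain ⟨t, rfl⟩ := hq
    exact .inr ⟨i, by rw [of_apply_eq_base]; exact h.base_mul t⟩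
  · exact .inr ⟨k, (IsReducedProd.of hq).mul hki h⟩

end IsReducedProd

theorem mem_range_base_or_exists_isReducedProd {φ : ∀ i, H →* G i} (r : PushoutI φ) :
    r ∈ (base φ).range ∨ ∃ i j, IsReducedProd φ i j r := by
  suffices h : ∀ s : PushoutI φ, (s ∈ (base φ).range ∨ ∃ i j, IsReducedProd φ i j s) →
      (r * s ∈ (base φ).range ∨ ∃ i j, IsReducedProd φ i j (r * s)) by
    simpa using h 1 (.inl (one_mem _))
  induction r using induction_on with
  | of k q =>
    rintro s (⟨t, rfl⟩ | ⟨i, j, hs⟩)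
    · rw [← of_apply_eq_base φ k, ← map_mul]
      by_cases hq : q * φ k t ∈ (φ k).range
      · obtain ⟨u, hu⟩ := hq
        exact .inl ⟨u, by rw [← hu, of_apply_eq_base]⟩
      · exact .inr ⟨k, k, .of hq⟩
    · exact (hs.of_mul q).imp_right fun ⟨m, hm⟩ => ⟨m, j, hm⟩
  | base t =>
    rintro s (hs | ⟨i, j, hs⟩)
    · exact .inl (mul_mem ⟨t, rfl⟩ hs)
    · exact .inr ⟨i, j, hs.base_mul t⟩
  | mul x y hx hy =>
    intro s hs
    rw [mul_assoc]
    exact hx _ (hy s hs)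

end Reduced

section Double

variable {Q : Type*} [Group Q] {T : Subgroup Q}

theorem exists_not_commute_of_isReducedProd
    (hT : ∀ g ∉ T, ∃ x ∉ T, x⁻¹ * g ∉ T) {i j : Bool}
    {r : PushoutI (fun _ : Bool => T.subtype)}
    (h : IsReducedProd (fun _ : Bool => T.subtype) i j r) :
    ∃ (k l : Bool) (x : Q), ¬ Commute r (of (φ := fun _ : Bool => T.subtype) k x *
      of (φ := fun _ : Bool => T.subtype) l x⁻¹) := by
  have hφ : ∀ _ : Bool, Function.Injective T.subtype := fun _ => T.subtype_injective
  obtain ⟨g, hg, hq⟩ := h.exists_head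
  obtain ⟨x, hx, hxg⟩ := hT g (by simpa using hg)
  have hred (k : Bool) : IsReducedProd (fun _ : Bool => T.subtype) k k (of k x) :=
    .of (by simpa using hx)
  have hred' (k : Bool) : IsReducedProd (fun _ : Bool => T.subtype) k k (of k x⁻¹) :=
    .of (by simpa using hx)
  have hhead := hq x⁻¹ (by simpa using hxg)
  by_cases hij : i = j
  · subst hij
    have hne : i ≠ !i := by simp
    refine ⟨!i, i, x, fun hc => ?_⟩
    refine ((((hhead.inv.mul hne (hred' !i)).mul hne.symm h).mul hne (hred !i)).mul hne.symm
      (hred' i)).notMem_range_base hφ ?_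
    convert Subgroup.one_mem _ using 1
    rw [map_inv] at hc
    simp only [map_inv]
    calc
      _ = r⁻¹ * (of i x * (of (!i) x)⁻¹) * (r * (of (!i) x * (of i x)⁻¹)) := by group
      _ = 1 := by rw [hc.eq]; group
  · refine ⟨i, j, x, fun hc => ?_⟩
    refine ((((h.inv.mul hij (hred j)).mul (Ne.symm hij) hhead).mul (Ne.symm hij) (hred i)).mul hij
      (hred' j)).notMem_range_base hφ ?_
    convert Subgroup.one_mem _ using 1
    rw [map_inv] at hc
    simp only [map_inv]
    calc
      _ = r⁻¹ * (of j x * (of i x)⁻¹) * (r * (of i x * (of j x)⁻¹)) := by group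
      _ = 1 := by rw [hc.eq]; group

end Double

end Monoid.PushoutI

theorem Subgroup.exists_notMem_inv_mul_notMem {Q : Type*} [Group Q] {T : Subgroup Q}
    (hT : T.index ≠ 2) {g : Q} (hg : g ∉ T) : ∃ x ∉ T, x⁻¹ * g ∉ T := by
  contrapose! hT
  exact Subgroup.index_eq_two_iff_exists_notMem_and.2
    ⟨g, hg, fun b => or_iff_not_imp_right.2 fun hb => by simpa using hT b⁻¹ (by simpa using hb)⟩

open Monoid.PushoutI in
/-- Let `Q` be a finite group of order at least `3` and `T ≤ Q` a subgroup containing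
no non-trivial normal subgroup of `Q`.  Let `R = Q *_T Q` be the amalgamated free
product of two copies of `Q` along `T` (realized as the pushout of the two inclusion
maps `T ↪ Q`), let `π̄ : R → Q` be the natural projection restricting to the identity
on each copy of `Q`, and let `F = ker π̄`.  Then the centralizer of `F` in `R` is
trivial. -/
theorem centralizer_of_amalgam_kernel_is_trivial
    (Q : Type*) [Group Q] [Finite Q] (hQ : 3 ≤ Nat.card Q)
    (T : Subgroup Q) (hT : ∀ N : Subgroup Q, N.Normal → N ≤ T → N = ⊥) :
    Subgroup.centralizer
        ((Monoid.PushoutI.lift (φ := fun _ : Bool => T.subtype)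
            (fun _ => MonoidHom.id Q) T.subtype
            (fun _ => MonoidHom.id_comp _)).ker :
          Set (Monoid.PushoutI (fun _ : Bool => T.subtype))) = ⊥ := by
  have hindex : T.index ≠ 2 := by
    intro h
    have hbot := hT T (Subgroup.normal_of_index_eq_two h) le_rfl
    rw [hbot, Subgroup.index_bot] at h
    omega
  set π := lift (φ := fun _ : Bool => T.subtype) (fun _ => MonoidHom.id Q) T.subtype
    (fun _ => MonoidHom.id_comp _)
  have hbase : Subgroup.centralizer (π.ker : Set _) ≤ (base fun _ : Bool => T.subtype).range := by
    intro r hr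
    refine (mem_range_base_or_exists_isReducedProd r).resolve_right ?_
    rintro ⟨i, j, h⟩
    obtain ⟨k, l, x, hx⟩ := exists_not_commute_of_isReducedProd
      (fun g => Subgroup.exists_notMem_inv_mul_notMem hindex) h
    exact hx (Subgroup.mem_centralizer_iff.1 hr _ (by simp [π, MonoidHom.mem_ker])).symm
  have hcomap : (Subgroup.centralizer (π.ker : Set _)).comap
      (of (φ := fun _ : Bool => T.subtype) true) = ⊥ := by
    refine hT _ inferInstance fun x hx => ?_
    obtain ⟨t, ht⟩ := hbase (Subgroup.mem_comap.1 hx)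
    rw [← of_apply_eq_base _ true] at ht
    exact of_injective (fun _ => T.subtype_injective) true ht ▸ t.2
  rw [eq_bot_iff]
  intro r hr
  obtain ⟨t, rfl⟩ := hbase hr
  rw [← of_apply_eq_base _ true] at hr ⊢
  have : T.subtype t ∈ (⊥ : Subgroup Q) := hcomap ▸ hr
  rw [Subgroup.mem_bot] at this ⊢
  rw [this, map_one]
end

section
/- Let Q be a finite group with |Q| ≥ 3 and let T ≤ Q be a subgroup such that the only normal subgroup of Q contained in T is the trivial subgroup. Let R = Q *_T Q be the free product of two copies of Q amalgamated along T (via the inclusion maps), let π̄ : R → Q be the natural projection which is the identity on each copy of Q, and let F = ker(π̄). If α is an automorphism of R satisfying α(F) = F and α(f) = f for all f ∈ F, then α is the identity automorphism of R. -/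
open Monoid Monoid.PushoutI

section ReducedList

variable {ι : Type*} {G : ι → Type*} {H : Type*} [∀ i, Group (G i)] [Group H]

/-- The product in an amalgamated product of a list of elements of the factors. -/
def amalgamListProd (φ : ∀ i, H →* G i) (l : List (Σ i, G i)) : PushoutI φ :=
  (l.map fun x => of x.1 x.2).prod

/-- A list of elements of the factors is reduced if consecutive letters come from different
factors and no letter lies in the base group. -/
def IsReducedList (φ : ∀ i, H →* G i) (l : List (Σ i, G i)) : Prop :=
  l.IsChain (fun x y => x.1 ≠ y.1) ∧ ∀ x ∈ l, x.2 ∉ (φ x.1).range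

/-- The formal inverse of a list of elements of the factors. -/
def listFormalInv (l : List (Σ i, G i)) : List (Σ i, G i) :=
  (l.map fun x => ⟨x.1, x.2⁻¹⟩).reverse

variable {φ : ∀ i, H →* G i}

theorem amalgamListProd_append (l l' : List (Σ i, G i)) :
    amalgamListProd φ (l ++ l') = amalgamListProd φ l * amalgamListProd φ l' := by
  simp [amalgamListProd]

theorem amalgamListProd_listFormalInv (l : List (Σ i, G i)) :
    amalgamListProd φ (listFormalInv l) = (amalgamListProd φ l)⁻¹ := by
  simp [amalgamListProd, listFormalInv, List.prod_inv_reverse, Function.comp_def]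

theorem IsReducedList.listFormalInv {l : List (Σ i, G i)} (hl : IsReducedList φ l) :
    IsReducedList φ (listFormalInv l) := by
  refine ⟨?_, ?_⟩
  · rw [_root_.listFormalInv, List.isChain_reverse, List.isChain_map]
    exact hl.1.imp fun _ _ h => h.symm
  · intro x hx
    simp only [_root_.listFormalInv, List.mem_reverse, List.mem_map] at hx
    obtain ⟨y, hy, rfl⟩ := hx
    simpa using hl.2 y hy

theorem IsReducedList.exists_normalWord {l : List (Σ i, G i)} (hl : IsReducedList φ l)
    (d : NormalWord.Transversal φ) :
    ∃ w : NormalWord d, w.prod = amalgamListProd φ l ∧ w.toList.length = l.length := by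
  let w : CoprodI.Word G :=
    ⟨l, fun x hx h => hl.2 x hx (h ▸ one_mem _), hl.1⟩
  obtain ⟨w', hprod, hmap⟩ := Reduced.exists_normalWord_prod_eq (w := w) d hl.2
  refine ⟨w', ?_, by simpa [w] using congrArg List.length hmap⟩
  rw [hprod, CoprodI.Word.prod, amalgamListProd, map_list_prod, List.map_map]
  simp [w, Function.comp_def]

theorem IsReducedList.length_eq_of_prod_eq (hφ : ∀ i, Function.Injective (φ i))
    {l l' : List (Σ i, G i)} (hl : IsReducedList φ l) (hl' : IsReducedList φ l')
    (h : amalgamListProd φ l = amalgamListProd φ l') : l.length = l'.length := by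
  obtain ⟨d⟩ := NormalWord.transversal_nonempty φ hφ
  obtain ⟨w, hw, hlen⟩ := hl.exists_normalWord d
  obtain ⟨w', hw', hlen'⟩ := hl'.exists_normalWord d
  obtain rfl : w = w' := NormalWord.prod_injective (by rw [hw, hw', h])
  rw [← hlen, hlen']

theorem exists_eq_base_mul_amalgamListProd (hφ : ∀ i, Function.Injective (φ i))
    (x : PushoutI φ) :
    ∃ (h : H) (l : List (Σ i, G i)), IsReducedList φ l ∧
      x = base φ h * amalgamListProd φ l := by
  classical
  obtain ⟨d⟩ := NormalWord.transversal_nonempty φ hφ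
  obtain ⟨w, rfl⟩ := (NormalWord.equiv (d := d)).symm.surjective x
  refine ⟨w.head, w.toList, ⟨w.chain_ne, fun y hy hr => w.ne_one y hy ?_⟩, ?_⟩
  · have := (d.compl y.1).1 (a₁ := (⟨y.2, hr⟩, ⟨1, d.one_mem y.1⟩))
      (a₂ := (⟨1, one_mem _⟩, ⟨y.2, w.normalized _ _ hy⟩)) (by simp)
    exact congrArg (fun z => (z.1 : G y.1)) this
  · change w.prod = _
    rw [NormalWord.prod, CoprodI.Word.prod, amalgamListProd, map_list_prod, List.map_map]
    simp [Function.comp_def]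

/-- Conjugating a reduced list by a reduced list without cancellation gives a reduced list. -/
theorem IsReducedList.conj {l f : List (Σ i, G i)} {x : Σ i, G i}
    (hl : IsReducedList φ (l ++ [x])) (hf : IsReducedList φ f) (hne : f ≠ [])
    (hhead : ∀ y ∈ f.head?, x.1 ≠ y.1) (hlast : ∀ y ∈ f.getLast?, y.1 ≠ x.1) :
    IsReducedList φ (l ++ [x] ++ f ++ _root_.listFormalInv (l ++ [x])) := by
  refine ⟨?_, ?_⟩
  · rw [List.isChain_append, List.isChain_append]
    refine ⟨⟨hl.1, hf.1, by simpa using hhead⟩, hl.listFormalInv.1, ?_⟩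
    rw [List.getLast?_append_of_ne_nil _ hne]
    simpa [_root_.listFormalInv] using hlast
  · intro y hy
    rw [List.mem_append, List.mem_append] at hy
    rcases hy with (hy | hy) | hy
    exacts [hl.2 y hy, hf.2 y hy, hl.listFormalInv.2 y hy]

end ReducedList

section Double

variable {Q : Type*} [Group Q] {T : Subgroup Q}

/-- A subgroup with trivial normal core in a group of order at least three has elements outside it
whose product is again outside it. -/
theorem exists_notMem_mul_notMem [Finite Q] (hQ : 3 ≤ Nat.card Q)
    (hT : ∀ N : Subgroup Q, N.Normal → N ≤ T → N = ⊥) :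
    ∃ q r : Q, q ∉ T ∧ r ∉ T ∧ q * r ∉ T := by
  by_contra! h
  have hnormal : T.Normal := by
    refine ⟨fun t ht g => ?_⟩
    by_cases hg : g ∈ T
    · exact mul_mem (mul_mem hg ht) (inv_mem hg)
    · exact h _ _ (by rwa [Subgroup.mul_mem_cancel_right _ ht]) (by simpa using hg)
  obtain rfl := hT T hnormal le_rfl
  have := Fintype.ofFinite Q
  have hlt : 2 < Fintype.card Q := by rwa [← Nat.card_eq_fintype_card]
  obtain ⟨a, b, c, hab, hac, hbc⟩ := Fintype.two_lt_card_iff.1 hlt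
  have := h (a⁻¹ * b) (b⁻¹ * c) (by simpa [inv_mul_eq_one] using hab)
    (by simpa [inv_mul_eq_one] using hbc)
  exact hac (by simpa [inv_mul_eq_one, mul_assoc] using this)

/-- The natural projection of the double of `Q` along `T` onto `Q`. -/
abbrev doubleProj (T : Subgroup Q) : PushoutI (fun _ : Bool => T.subtype) →* Q :=
  PushoutI.lift (φ := fun _ : Bool => T.subtype) (fun _ => MonoidHom.id Q) T.subtype
    (fun _ => MonoidHom.id_comp _)

theorem mem_range_base_of_commute_ker [Finite Q] (hQ : 3 ≤ Nat.card Q)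
    (hT : ∀ N : Subgroup Q, N.Normal → N ≤ T → N = ⊥)
    {c : PushoutI (fun _ : Bool => T.subtype)}
    (hc : ∀ f ∈ (doubleProj T).ker, Commute c f) :
    c ∈ (base (fun _ : Bool => T.subtype)).range := by
  have hinj : ∀ _ : Bool, Function.Injective T.subtype := fun _ => T.subtype_injective
  obtain ⟨h, l, hl, rfl⟩ := exists_eq_base_mul_amalgamListProd hinj c
  rcases l.eq_nil_or_concat with rfl | ⟨l, ⟨i, x⟩, rfl⟩
  · exact ⟨h, by simp [amalgamListProd]⟩
  exfalso
  rw [List.concat_eq_append] at hl hc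
  obtain ⟨q, r, hq, hr, hqr⟩ := exists_notMem_mul_notMem hQ hT
  let word (a b : Q) : List (Σ _ : Bool, Q) := [⟨!i, a⟩, ⟨i, r⟩, ⟨!i, b⟩]
  have hword (a b : Q) (ha : a ∉ T) (hb : b ∉ T) :
      IsReducedList (fun _ : Bool => T.subtype) (word a b) := by
    simp [word, IsReducedList, ha, hb, hr]
  have hs : (q * r)⁻¹ ∉ T := by rwa [inv_mem_iff]
  set p := amalgamListProd (fun _ : Bool => T.subtype) (l ++ [⟨i, x⟩]) with hp
  have hcomm := hc (amalgamListProd _ (word q (q * r)⁻¹)) (by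
    simp [word, amalgamListProd, MonoidHom.mem_ker])
  have hbase (j : Bool) : base (fun _ : Bool => T.subtype) h = of j (h : Q) :=
    (of_apply_eq_base (fun _ : Bool => T.subtype) j h).symm
  have hconj : amalgamListProd (fun _ : Bool => T.subtype)
        (l ++ [⟨i, x⟩] ++ word q (q * r)⁻¹ ++ listFormalInv (l ++ [⟨i, x⟩])) =
      amalgamListProd _ (word ((h : Q)⁻¹ * q) ((q * r)⁻¹ * h)) := by
    have hright : amalgamListProd (fun _ : Bool => T.subtype)
        (word ((h : Q)⁻¹ * q) ((q * r)⁻¹ * h)) =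
        (base _ h)⁻¹ * amalgamListProd _ (word q (q * r)⁻¹) * base _ h := by
      rw [hbase !i]
      simp only [word, amalgamListProd, List.map_cons, List.map_nil, List.prod_cons,
        List.prod_nil, map_mul, map_inv, mul_one, mul_assoc]
    rw [hright, amalgamListProd_append, amalgamListProd_append, amalgamListProd_listFormalInv,
      ← hp, mul_inv_eq_iff_eq_mul, mul_assoc _ _ (base _ h), mul_assoc, mul_assoc,
      eq_inv_mul_iff_mul_eq, ← mul_assoc]
    exact hcomm.eq
  have hlen := IsReducedList.length_eq_of_prod_eq hinj
    (hl.conj (hword _ _ hq hs) (by simp [word]) (by simp [word]) (by simp [word]))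
    (hword _ _ (by rwa [Subgroup.mul_mem_cancel_left _ (inv_mem h.2)])
      (by rwa [Subgroup.mul_mem_cancel_right _ h.2])) hconj
  simp [word, listFormalInv] at hlen
  omega

/-- The kernel of the natural projection of the double has trivial centralizer. -/
theorem eq_one_of_commute_ker [Finite Q] (hQ : 3 ≤ Nat.card Q)
    (hT : ∀ N : Subgroup Q, N.Normal → N ≤ T → N = ⊥)
    {c : PushoutI (fun _ : Bool => T.subtype)}
    (hc : ∀ f ∈ (doubleProj T).ker, Commute c f) : c = 1 := by
  have hinj : ∀ _ : Bool, Function.Injective T.subtype := fun _ => T.subtype_injective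
  obtain ⟨h, rfl⟩ := mem_range_base_of_commute_ker hQ hT hc
  have hbase (j : Bool) (t : T) : base (fun _ : Bool => T.subtype) t = of j (t : Q) :=
    (of_apply_eq_base (fun _ : Bool => T.subtype) j t).symm
  have hcore : (h : Q) ∈ T.normalCore := by
    intro q
    have hcomm := (hc (of true q⁻¹ * (of false q⁻¹)⁻¹) (by simp [MonoidHom.mem_ker])).eq
    have heq : of (φ := fun _ : Bool => T.subtype) true (q * h * q⁻¹) =
        of false (q * h * q⁻¹) := by
      rw [← mul_assoc, hbase true] at hcomm
      have hft : of (φ := fun _ : Bool => T.subtype) true (h : Q) = of false (h : Q) := by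
        rw [← hbase, ← hbase]
      simp only [map_mul, map_inv, inv_inv] at hcomm ⊢
      rw [← hft, eq_mul_inv_iff_mul_eq, mul_assoc, mul_assoc, ← eq_inv_mul_iff_mul_eq, ← mul_assoc,
        ← mul_assoc, hcomm]
    have hmem : of (φ := fun _ : Bool => T.subtype) true (q * h * q⁻¹) ∈
        (base (fun _ : Bool => T.subtype)).range := by
      rw [← inf_of_range_eq_base_range hinj (i := true) (j := false) (by decide)]
      exact ⟨⟨_, rfl⟩, ⟨_, heq.symm⟩⟩
    obtain ⟨t, ht⟩ := hmem
    rw [hbase true] at ht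
    exact of_injective hinj true ht ▸ t.2
  have hone := hT _ T.normalCore_normal T.normalCore_le
  rw [hone, Subgroup.mem_bot, OneMemClass.coe_eq_one] at hcore
  rw [hcore, map_one]

end Double


/-- Let `Q` be a finite group of order at least `3` and `T ≤ Q` a subgroup containing
no non-trivial normal subgroup of `Q`.  Let `R = Q *_T Q` be the amalgamated free
product of two copies of `Q` along `T` (realized as the pushout of the two inclusion
maps `T ↪ Q`), let `π̄ : R → Q` be the natural projection restricting to the identity
on each copy of `Q`, and let `F = ker π̄`.  Any automorphism `α` of `R` with
`α(F) = F` and `α|_F = id` is the identity automorphism of `R`. -/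
theorem auto_of_amalgam_fixing_kernel_is_id
    (Q : Type*) [Group Q] [Finite Q] (hQ : 3 ≤ Nat.card Q)
    (T : Subgroup Q) (hT : ∀ N : Subgroup Q, N.Normal → N ≤ T → N = ⊥)
    (α : MulAut (Monoid.PushoutI (fun _ : Bool => T.subtype)))
    (hker : Subgroup.map α.toMonoidHom
        (Monoid.PushoutI.lift (φ := fun _ : Bool => T.subtype)
          (fun _ => MonoidHom.id Q) T.subtype
          (fun _ => MonoidHom.id_comp _)).ker =
      (Monoid.PushoutI.lift (φ := fun _ : Bool => T.subtype)
          (fun _ => MonoidHom.id Q) T.subtype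
          (fun _ => MonoidHom.id_comp _)).ker)
    (hfix : ∀ f ∈ (Monoid.PushoutI.lift (φ := fun _ : Bool => T.subtype)
          (fun _ => MonoidHom.id Q) T.subtype
          (fun _ => MonoidHom.id_comp _)).ker, α f = f) :
    ∀ x, α x = x := by
  intro x
  refine (inv_mul_eq_one.1 (eq_one_of_commute_ker hQ hT fun f hf => ?_)).symm
  have hconj := hfix (x * f * x⁻¹) ((MonoidHom.normal_ker _).conj_mem f hf x)
  rw [map_mul, map_mul, map_inv, hfix f hf, mul_inv_eq_iff_eq_mul] at hconj
  rw [Commute, SemiconjBy, mul_assoc, hconj]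
  group
end

section
/- Let Q be a finite group with |Q| ≥ 3 and let T ≤ Q be a subgroup such that the only normal subgroup of Q contained in T is the trivial subgroup. Let R = Q*_T be the HNN extension of Q with both associated subgroups equal to T and associated isomorphism the identity of T, let π̄ : R → Q be the natural projection which is the identity on Q and sends the stable letter to the identity, and let F = ker(π̄). Then F is a free group of rank at least 2; in particular F is a non-abelian free group. -/
namespace HNNExtension

variable {Q : Type*} [Group Q] (T : Subgroup Q)

/-- The action of `Q` on the free group on `Q ⧸ T` permuting the basis by left translation. -/
def cosetAction : Q →* MulAut (FreeGroup (Q ⧸ T)) where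
  toFun q := FreeGroup.freeGroupCongr (MulAction.toPerm q)
  map_one' := by
    apply MulEquiv.toMonoidHom_injective
    ext x
    simp
  map_mul' p q := by
    apply MulEquiv.toMonoidHom_injective
    ext x
    simp [mul_smul]

@[simp]
theorem cosetAction_of (q : Q) (x : Q ⧸ T) :
    cosetAction T q (FreeGroup.of x) = FreeGroup.of (q • x) := by
  simp [cosetAction]

theorem t_commute_of (a : T) :
    t * (of (a : Q) : HNNExtension Q T T (MulEquiv.refl T)) = of (a : Q) * t :=
  t_mul_of a

/-- The conjugate `q t q⁻¹` of the stable letter, which depends only on the coset `qT`. -/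
def conjStable : Q ⧸ T → HNNExtension Q T T (MulEquiv.refl T) :=
  Quotient.lift (fun q : Q => of q * t * (of q)⁻¹) <| by
    intro p q h
    have h' : p⁻¹ * q ∈ T := QuotientGroup.leftRel_apply.mp h
    have hq : q = p * (⟨p⁻¹ * q, h'⟩ : T) := by simp
    change of p * t * (of p)⁻¹ = of q * t * (of q)⁻¹
    rw [hq, map_mul, mul_assoc (of p) (of _) t, ← t_commute_of]
    group

@[simp]
theorem conjStable_mk (q : Q) :
    conjStable T (QuotientGroup.mk q) = of q * t * (of q)⁻¹ := rfl

theorem conjStable_smul (q : Q) (x : Q ⧸ T) :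
    conjStable T (q • x) = of q * conjStable T x * (of q)⁻¹ := by
  induction x using QuotientGroup.induction_on with
  | H p =>
    change conjStable T (QuotientGroup.mk (q * p)) = _
    simp [mul_assoc]

/-- The canonical homomorphism from the HNN extension to `FreeGroup (Q ⧸ T) ⋊ Q`. -/
def toSemidirect :
    HNNExtension Q T T (MulEquiv.refl T) →* FreeGroup (Q ⧸ T) ⋊[cosetAction T] Q :=
  lift SemidirectProduct.inr (SemidirectProduct.inl (FreeGroup.of (QuotientGroup.mk 1))) <| by
    intro a
    have h : (a : Q) • (QuotientGroup.mk 1 : Q ⧸ T) = QuotientGroup.mk 1 := by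
      change (QuotientGroup.mk ((a : Q) * 1) : Q ⧸ T) = _
      rw [QuotientGroup.eq]
      simp
    ext <;> simp [h]

/-- The canonical homomorphism from `FreeGroup (Q ⧸ T) ⋊ Q` to the HNN extension. -/
def ofSemidirect :
    FreeGroup (Q ⧸ T) ⋊[cosetAction T] Q →* HNNExtension Q T T (MulEquiv.refl T) :=
  SemidirectProduct.lift (FreeGroup.lift (conjStable T)) of <| by
    intro q
    ext x
    simp [conjStable_smul]

theorem ofSemidirect_toSemidirect (x : HNNExtension Q T T (MulEquiv.refl T)) :
    ofSemidirect T (toSemidirect T x) = x := by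
  have h : (ofSemidirect T).comp (toSemidirect T) = MonoidHom.id _ := by
    apply hom_ext
    · ext q
      simp [ofSemidirect, toSemidirect]
    · simp [ofSemidirect, toSemidirect]
  exact DFunLike.congr_fun h x

theorem toSemidirect_lift_conjStable (w : FreeGroup (Q ⧸ T)) :
    toSemidirect T (FreeGroup.lift (conjStable T) w) = SemidirectProduct.inl w := by
  have h : (toSemidirect T).comp (FreeGroup.lift (conjStable T)) = SemidirectProduct.inl := by
    ext1 x
    induction x using QuotientGroup.induction_on with
    | H q =>
      have hq : q • (QuotientGroup.mk 1 : Q ⧸ T) = QuotientGroup.mk q := by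
        change (QuotientGroup.mk (q * 1) : Q ⧸ T) = _
        rw [mul_one]
      rw [← hq, ← cosetAction_of, SemidirectProduct.inl_aut]
      simp [toSemidirect, hq]
  exact DFunLike.congr_fun h w

/-- If `π` is the identity on `Q` and kills the stable letter, its kernel is free on `Q ⧸ T`. -/
theorem ker_mulEquiv_freeGroup (π : HNNExtension Q T T (MulEquiv.refl T) →* Q)
    (hof : ∀ q, π (of q) = q) (ht : π t = 1) :
    Nonempty (π.ker ≃* FreeGroup (Q ⧸ T)) := by
  have hker (w : FreeGroup (Q ⧸ T)) : FreeGroup.lift (conjStable T) w ∈ π.ker := by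
    have h : π.comp (FreeGroup.lift (conjStable T)) = 1 := by
      ext1 x
      induction x using QuotientGroup.induction_on with
      | H q => simp [hof, ht]
    exact DFunLike.congr_fun h w
  have hright : SemidirectProduct.rightHom.comp (toSemidirect T) = π := by
    apply hom_ext
    · ext q
      simp [toSemidirect, hof]
    · simp [toSemidirect, ht]
  refine ⟨(MulEquiv.ofBijective ((FreeGroup.lift (conjStable T)).codRestrict π.ker hker)
    ⟨?_, ?_⟩).symm⟩
  · intro v w h
    apply SemidirectProduct.inl_injective (φ := cosetAction T)
    rw [← toSemidirect_lift_conjStable, ← toSemidirect_lift_conjStable]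
    exact congrArg (toSemidirect T) (congrArg Subtype.val h)
  · rintro ⟨x, hx⟩
    refine ⟨(toSemidirect T x).left, Subtype.ext ?_⟩
    have hx' : (toSemidirect T x).right = 1 := (DFunLike.congr_fun hright x).trans hx
    change _ = x
    conv_rhs => rw [← ofSemidirect_toSemidirect T x,
      ← SemidirectProduct.inl_left_mul_inr_right (toSemidirect T x), hx']
    simp [ofSemidirect]

end HNNExtension

/-- Let `Q` be a finite group of order at least `3` and `T ≤ Q` a subgroup containing
no non-trivial normal subgroup of `Q`.  Let `R = Q*_T` be the HNN extension of `Q`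
with both associated subgroups equal to `T` and associated isomorphism the identity,
and let `π̄ : R → Q` be the natural projection restricting to the identity on `Q` and
sending the stable letter to `1`.  Then `F = ker π̄` is a free group of rank at
least `2`; in particular it is a non-abelian free group. -/
theorem kernel_of_hnn_projection_is_free
    (Q : Type*) [Group Q] [Finite Q] (hQ : 3 ≤ Nat.card Q)
    (T : Subgroup Q) (hT : ∀ N : Subgroup Q, N.Normal → N ≤ T → N = ⊥) :
    ∃ m : ℕ, 2 ≤ m ∧
      Nonempty
        ((HNNExtension.lift (G := Q) (A := T) (B := T) (φ := MulEquiv.refl T)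
            (MonoidHom.id Q) 1 (fun a => by simp)).ker ≃* FreeGroup (Fin m)) := by
  have hT' : T ≠ ⊤ := by
    intro h
    have htop : (⊤ : Subgroup Q) = ⊥ := hT ⊤ inferInstance h.ge
    have hcard : Nat.card (⊤ : Subgroup Q) = 1 := by rw [htop, Subgroup.card_bot]
    rw [Subgroup.card_top] at hcard
    omega
  refine ⟨T.index, T.one_lt_index_of_ne_top hT', ?_⟩
  obtain ⟨e⟩ := HNNExtension.ker_mulEquiv_freeGroup T
    (HNNExtension.lift (MonoidHom.id Q) 1 (fun a => by simp)) (by simp) (by simp)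
  exact ⟨e.trans (FreeGroup.freeGroupCongr (Finite.equivFin (Q ⧸ T)))⟩
end

section
/- Let Q be a finite group with |Q| ≥ 3 and let T ≤ Q be a subgroup such that the only normal subgroup of Q contained in T is the trivial subgroup. Let R = Q*_T be the HNN extension of Q with both associated subgroups equal to T and associated isomorphism the identity of T, let π̄ : R → Q be the natural projection which is the identity on Q and sends the stable letter to the identity, and let F = ker(π̄). Then the centralizer of F in R is trivial: C_R(F) = {e}. -/
namespace FreeGroup

variable {α : Type*}

/-- Generators of a free group are conjugate only if they are equal. -/
theorem eq_of_isConj_of {a b : α} (h : IsConj (of a) (of b)) : a = b := by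
  classical
  have hmap := isConj_iff_eq.1 <|
    MonoidHom.map_isConj (lift fun c => if c = a then Multiplicative.ofAdd (1 : ℤ) else 1) h
  by_contra hab
  simp [Ne.symm hab] at hmap

/-- The center of a free group of rank at least two is trivial. -/
theorem center_eq_bot [Nontrivial α] : Subgroup.center (FreeGroup α) = ⊥ := by
  classical
  refine (Subgroup.eq_bot_iff_forall _).2 fun w hw => ?_
  rw [Subgroup.mem_center_iff] at hw
  rw [← toWord_eq_nil_iff]
  rcases hL : w.toWord with _ | ⟨⟨c, s⟩, L⟩
  · rfl
  obtain ⟨x, hx⟩ := exists_ne c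
  have hred : IsReduced ((x, true) :: w.toWord) := by
    have hred_w : IsReduced w.toWord := isReduced_toWord
    rw [hL] at hred_w ⊢
    exact isReduced_cons_cons.2 ⟨fun h => absurd h hx, hred_w⟩
  have hleft : (of x * w).toWord = (x, true) :: w.toWord := by
    rw [toWord_mul, toWord_of]
    exact hred.reduce_eq
  have hright := toWord_mul_sublist w (of x)
  rw [← hw, hleft, toWord_of] at hright
  have heq := hright.eq_of_length (by simp)
  rw [hL] at heq
  simp [hx] at heq

/-- The action of `G` on the free group on a `G`-set by permuting the generators. -/
def permAut (G α : Type*) [Group G] [MulAction G α] : G →* MulAut (FreeGroup α) where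
  toFun g := freeGroupCongr (MulAction.toPerm g)
  map_one' := by
    refine MulEquiv.toMonoidHom_injective (ext_hom _ _ fun a => ?_)
    simp
  map_mul' g h := by
    refine MulEquiv.toMonoidHom_injective (ext_hom _ _ fun a => ?_)
    simp [mul_smul]

@[simp]
theorem permAut_of {G : Type*} [Group G] [MulAction G α] (g : G) (a : α) :
    permAut G α g (of a) = of (g • a) := by
  simp [permAut]

end FreeGroup

namespace HNNExtension

variable {Q : Type*} [Group Q] (T : Subgroup Q)

/-- The semidirect product of the free group on `Q ⧸ T` with `Q`. -/
abbrev FreeSemidirect : Type _ :=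
  FreeGroup (Q ⧸ T) ⋊[FreeGroup.permAut Q (Q ⧸ T)] Q

/-- The map from the HNN extension of `Q` along the identity of `T` to the semidirect product of
the free group on `Q ⧸ T` with `Q`, sending the stable letter to the generator `T`. -/
def toFreeSemidirect : HNNExtension Q T T (MulEquiv.refl T) →* FreeSemidirect T :=
  lift SemidirectProduct.inr (SemidirectProduct.inl (FreeGroup.of ((1 : Q) : Q ⧸ T))) fun a => by
    have ha : ((a : Q) • ((1 : Q) : Q ⧸ T)) = ((1 : Q) : Q ⧸ T) := by
      rw [MulAction.Quotient.smul_coe, QuotientGroup.eq]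
      simp
    ext <;> simp [ha]

@[simp]
theorem toFreeSemidirect_of (q : Q) :
    toFreeSemidirect T (of q) = SemidirectProduct.inr q := by
  simp [toFreeSemidirect]

@[simp]
theorem toFreeSemidirect_t :
    toFreeSemidirect T t = SemidirectProduct.inl (FreeGroup.of ((1 : Q) : Q ⧸ T)) := by
  simp [toFreeSemidirect]

theorem toFreeSemidirect_conj_t (q : Q) :
    toFreeSemidirect T (of q * t * (of q)⁻¹) =
      SemidirectProduct.inl (FreeGroup.of (q : Q ⧸ T)) := by
  rw [map_mul, map_mul, map_inv, toFreeSemidirect_of, toFreeSemidirect_t, ← map_inv,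
    ← SemidirectProduct.inl_aut]
  simp

/-- The conjugate `q t q⁻¹` of the stable letter depends only on the coset `qT`. -/
def conjT (x : Q ⧸ T) : HNNExtension Q T T (MulEquiv.refl T) :=
  Quotient.liftOn' x (fun q => of q * t * (of q)⁻¹) fun p q h => by
    rw [QuotientGroup.leftRel_apply] at h
    obtain ⟨a, rfl⟩ : ∃ a : T, p * a = q := ⟨⟨_, h⟩, mul_inv_cancel_left p q⟩
    have ha := of_mul_t (φ := MulEquiv.refl T) a
    rw [MulEquiv.refl_symm, MulEquiv.refl_apply] at ha
    rw [map_mul, mul_assoc (of p) (of (a : Q)) t, ha]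
    simp [mul_assoc]

theorem conjT_coe (q : Q) : conjT T (q : Q ⧸ T) = of q * t * (of q)⁻¹ := rfl

/-- The left inverse of `toFreeSemidirect`. -/
def ofFreeSemidirect : FreeSemidirect T →* HNNExtension Q T T (MulEquiv.refl T) :=
  SemidirectProduct.lift (FreeGroup.lift (conjT T)) of fun q => by
    ext x
    induction x using QuotientGroup.induction_on with
    | H p => simp [conjT_coe, mul_assoc]

theorem toFreeSemidirect_injective : Function.Injective (toFreeSemidirect T) := by
  have h : (ofFreeSemidirect T).comp (toFreeSemidirect T) = MonoidHom.id _ := by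
    apply hom_ext
    · ext q
      simp [ofFreeSemidirect]
    · simp [ofFreeSemidirect, conjT_coe]
  have hleft : Function.LeftInverse (ofFreeSemidirect T) (toFreeSemidirect T) :=
    DFunLike.congr_fun h
  exact hleft.injective

end HNNExtension

open HNNExtension

/-- Let `Q` be a finite group of order at least `3` and `T ≤ Q` a subgroup containing
no non-trivial normal subgroup of `Q`.  Let `R = Q*_T` be the HNN extension of `Q`
with both associated subgroups equal to `T` and associated isomorphism the identity,
let `π̄ : R → Q` be the natural projection restricting to the identity on `Q` and
sending the stable letter to `1`, and let `F = ker π̄`.  Then the centralizer of `F`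
in `R` is trivial. -/
theorem centralizer_of_hnn_kernel_is_trivial
    (Q : Type*) [Group Q] [Finite Q] (hQ : 3 ≤ Nat.card Q)
    (T : Subgroup Q) (hT : ∀ N : Subgroup Q, N.Normal → N ≤ T → N = ⊥) :
    Subgroup.centralizer
        ((HNNExtension.lift (G := Q) (A := T) (B := T) (φ := MulEquiv.refl T)
            (MonoidHom.id Q) 1 (fun a => by simp)).ker :
          Set (HNNExtension Q T T (MulEquiv.refl T))) = ⊥ := by
  refine (Subgroup.eq_bot_iff_forall _).2 fun r hr => toFreeSemidirect_injective T ?_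
  rw [map_one]
  obtain ⟨w, q, hwq⟩ : ∃ w q, toFreeSemidirect T r = ⟨w, q⟩ := ⟨_, _, rfl⟩
  rw [hwq]
  have hcomm (x : Q ⧸ T) : w * FreeGroup.of (q • x) = FreeGroup.of x * w := by
    induction x using QuotientGroup.induction_on with
    | H p =>
      have h := congrArg (toFreeSemidirect T) <|
        Subgroup.mem_centralizer_iff.1 hr (of p * t * (of p)⁻¹) (by simp)
      rw [map_mul, map_mul _ r, toFreeSemidirect_conj_t, hwq] at h
      simpa using (congrArg SemidirectProduct.left h).symm
  have hfix (x : Q ⧸ T) : q • x = x :=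
    FreeGroup.eq_of_isConj_of <| isConj_iff.2 ⟨w, by rw [hcomm, mul_inv_cancel_right]⟩
  have hq : q = 1 := by
    rw [← Subgroup.mem_bot, ← hT T.normalCore T.normalCore_normal T.normalCore_le,
      Subgroup.normalCore_eq_ker]
    exact Equiv.ext hfix
  have : Nontrivial (Q ⧸ T) := by
    rw [QuotientGroup.nontrivial_iff]
    rintro rfl
    have := hT ⊤ inferInstance le_rfl
    have hcard := Subgroup.card_top (G := Q)
    rw [this, Subgroup.card_bot] at hcard
    omega
  have hw : w = 1 := by
    rw [← Subgroup.mem_bot, ← FreeGroup.center_eq_bot (α := Q ⧸ T), Subgroup.mem_center_iff]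
    suffices (MulAut.conj w).toMonoidHom = MonoidHom.id _ from fun g =>
      (mul_inv_eq_iff_eq_mul.1 (DFunLike.congr_fun this g)).symm
    ext x
    simpa [hfix, mul_inv_eq_iff_eq_mul] using hcomm x
  rw [hw, hq]
  rfl
end

section
/- Let N be a group, let Δ be a normal subgroup of N of finite index, and let M be a normal subgroup of N with M ≤ Δ such that Δ/M is isomorphic to a free group F_r on r ≥ 2 generators. Let C = {n ∈ N : n⁻¹δn·δ⁻¹ ∈ M for all δ ∈ Δ} be the kernel of the conjugation action of N on Δ/M, and let D = ΔC. Then Δ ∩ C = M, the group C/M is finite, and D/M is isomorphic to the direct product (Δ/M) × (C/M). -/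
/-- A free group on at least two generators has trivial center. -/
theorem FreeGroup.center_eq_bot_s13 {α : Type*} [Nontrivial α] :
    Subgroup.center (FreeGroup α) = ⊥ := by
  classical
  refine (Subgroup.eq_bot_iff_forall _).2 fun x hx => ?_
  by_contra hne
  have hw : x.toWord ≠ [] := fun h => hne (FreeGroup.toWord_eq_nil_iff.1 h)
  obtain ⟨p, L, hL⟩ := List.exists_cons_of_ne_nil hw
  obtain ⟨c, hc⟩ := exists_ne p.1
  have hred : (FreeGroup.of c * x).toWord = (c, true) :: x.toWord := by
    rw [FreeGroup.toWord_mul, FreeGroup.toWord_of, List.singleton_append]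
    apply FreeGroup.IsReduced.reduce_eq
    have hx' := FreeGroup.isReduced_toWord (x := x)
    rw [hL] at hx' ⊢
    exact FreeGroup.isReduced_cons_cons.2 ⟨fun h => absurd h hc, hx'⟩
  have hsub := FreeGroup.toWord_mul_sublist x (FreeGroup.of c)
  rw [← Subgroup.mem_center_iff.1 hx (FreeGroup.of c), hred, FreeGroup.toWord_of] at hsub
  have heq := hsub.eq_of_length (by simp)
  rw [hL] at heq
  exact hc (congrArg Prod.fst (List.cons.inj heq).1)

/-- If normal subgroups `H` and `K` commute modulo `M = H ⊓ K`, then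
`HK/M` is the direct product of `H/M` and `K/M`. -/
theorem Subgroup.nonempty_sup_quotient_mulEquiv_prod {G : Type*} [Group G]
    {H K M : Subgroup G} [H.Normal] [M.Normal] (hM : H ⊓ K = M)
    (hcomm : ∀ k ∈ K, ∀ h ∈ H, k⁻¹ * h * k * h⁻¹ ∈ M) :
    Nonempty (((H ⊔ K : Subgroup G) ⧸ M.subgroupOf (H ⊔ K)) ≃*
      (H ⧸ M.subgroupOf H) × (K ⧸ M.subgroupOf K)) := by
  let i : H →* (H ⊔ K : Subgroup G) := Subgroup.inclusion le_sup_left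
  let j : K →* (H ⊔ K : Subgroup G) := Subgroup.inclusion le_sup_right
  let f := QuotientGroup.map (M.subgroupOf H) (M.subgroupOf (H ⊔ K)) i fun _ hx => hx
  let g := QuotientGroup.map (M.subgroupOf K) (M.subgroupOf (H ⊔ K)) j fun _ hx => hx
  have hfg : ∀ a b, Commute (f a) (g b) := by
    rintro ⟨h⟩ ⟨k⟩
    refine (QuotientGroup.eq (a := i h * j k) (b := j k * i h)).2 ?_
    change ((h : G) * k)⁻¹ * (k * h) ∈ M
    have := hcomm k k.2 _ (inv_mem h.2)
    simpa [mul_assoc] using this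
  let F := f.noncommCoprod g hfg
  have hker : ∀ a, F a = 1 → a = 1 := by
    rintro ⟨⟨h⟩, ⟨k⟩⟩ he
    have hhk : (h : G) * k ∈ M := (QuotientGroup.eq_one_iff (i h * j k)).1 he
    have hH : (h : G) * k ∈ H := (hM.symm ▸ hhk : (h : G) * k ∈ H ⊓ K).1
    have hK : (h : G) * k ∈ K := (hM.symm ▸ hhk : (h : G) * k ∈ H ⊓ K).2
    have hh : (h : G) ∈ M := hM ▸ ⟨h.2, (mul_mem_cancel_right k.2).1 hK⟩
    have hk : (k : G) ∈ M := hM ▸ ⟨(mul_mem_cancel_left h.2).1 hH, k.2⟩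
    exact Prod.ext ((QuotientGroup.eq_one_iff h).2 hh) ((QuotientGroup.eq_one_iff k).2 hk)
  have hsurj : Function.Surjective F := by
    rintro ⟨⟨x, hx⟩⟩
    obtain ⟨h, hh, k, hk, rfl⟩ := Subgroup.mem_sup_of_normal_left.1 hx
    exact ⟨(QuotientGroup.mk ⟨h, hh⟩, QuotientGroup.mk ⟨k, hk⟩), rfl⟩
  exact ⟨(MulEquiv.ofBijective F ⟨(injective_iff_map_eq_one F).2 hker, hsurj⟩).symm⟩

/-- Let `N` be a group, `Δ ⊴ N` of finite index, and `M ⊴ N` with `M ≤ Δ` and `Δ/M`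
isomorphic to a free group on `r ≥ 2` generators.  Let `C` be the kernel of the
conjugation action of `N` on `Δ/M` and `D = ΔC`.  Then `Δ ∩ C = M`, the group `C/M`
is finite, and `D/M ≅ (Δ/M) × (C/M)`. -/
theorem kernel_of_action_on_free_quotient
    (N : Type*) [Group N]
    (Δ M : Subgroup N) (hΔ : Δ.Normal) (hΔfin : Δ.index ≠ 0)
    (hM : M.Normal) (hMΔ : M ≤ Δ)
    (r : ℕ) (hr : 2 ≤ r)
    (hfree : Nonempty ((Δ ⧸ M.subgroupOf Δ) ≃* FreeGroup (Fin r)))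
    (C : Subgroup N)
    (hC : ∀ x : N, x ∈ C ↔ ∀ δ ∈ Δ, x⁻¹ * δ * x * δ⁻¹ ∈ M) :
    Δ ⊓ C = M ∧
    Finite (C ⧸ M.subgroupOf C) ∧
    Nonempty (((Δ ⊔ C : Subgroup N) ⧸ M.subgroupOf (Δ ⊔ C)) ≃*
      (Δ ⧸ M.subgroupOf Δ) × (C ⧸ M.subgroupOf C)) := by
  have : Nontrivial (Fin r) := Fin.nontrivial_iff_two_le.2 hr
  obtain ⟨e⟩ := hfree
  have hMC : Δ ⊓ C = M := by
    apply le_antisymm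
    · rintro x ⟨hxΔ, hxC⟩
      let q : Δ ⧸ M.subgroupOf Δ := QuotientGroup.mk ⟨x, hxΔ⟩
      have hq : ∀ y, y * q = q * y := by
        rintro ⟨δ⟩
        refine ((QuotientGroup.eq (a := ⟨x, hxΔ⟩ * δ) (b := δ * ⟨x, hxΔ⟩)).2 ?_).symm
        change (x * (δ : N))⁻¹ * (δ * x) ∈ M
        have := (hC x).1 hxC _ δ.2
        rw [hM.mem_comm_iff] at this
        simpa [mul_assoc] using this
      have he : e q ∈ Subgroup.center (FreeGroup (Fin r)) :=
        Subgroup.mem_center_iff.2 fun y => by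
          simpa using congrArg e (hq (e.symm y))
      rw [FreeGroup.center_eq_bot_s13, Subgroup.mem_bot, map_eq_one_iff e e.injective] at he
      exact (QuotientGroup.eq_one_iff (N := M.subgroupOf Δ) ⟨x, hxΔ⟩).1 he
    · refine fun x hx => ⟨hMΔ hx, (hC x).2 fun δ _ => ?_⟩
      simpa [mul_assoc] using mul_mem (inv_mem hx) (hM.conj_mem x hx δ)
  refine ⟨hMC, ?_, Subgroup.nonempty_sup_quotient_mulEquiv_prod hMC fun k hk => (hC k).1 hk⟩
  have : Δ.FiniteIndex := ⟨hΔfin⟩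
  rw [← hMC, Subgroup.inf_subgroupOf_right]
  infer_instance
end

section
/- Let G be a finite group of order g ≥ 2, let d = ⌈log₂ g⌉, and let m ≥ d be a natural number. Then the number of surjective group homomorphisms from the free group F_m on m generators onto G is at least g^{m − d}. -/
theorem Subgroup.two_mul_card_le_card_of_lt {G : Type*} [Group G] [Finite G] {H K : Subgroup G}
    (h : H < K) : 2 * Nat.card H ≤ Nat.card K := by
  obtain ⟨k, hk⟩ := Subgroup.card_dvd_of_le h.le
  have hK : 0 < Nat.card K := Nat.card_pos
  have hk0 : k ≠ 0 := by rintro rfl; omega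
  have hk1 : k ≠ 1 := by
    rintro rfl
    exact h.ne (Subgroup.eq_of_le_of_card_ge h.le (by omega))
  rw [hk, mul_comm]
  exact Nat.mul_le_mul_left _ (by omega)

theorem exists_closure_range_eq_top_or_two_pow_le_card (G : Type*) [Group G] [Finite G] (n : ℕ) :
    ∃ v : Fin n → G, Subgroup.closure (Set.range v) = ⊤ ∨
      2 ^ n ≤ Nat.card (Subgroup.closure (Set.range v)) := by
  induction n with
  | zero => exact ⟨Fin.elim0, Or.inr Nat.card_pos⟩
  | succ n ih =>
    obtain ⟨v, hv⟩ := ih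
    have hle (x : G) : Subgroup.closure (Set.range v) ≤
        Subgroup.closure (Set.range (Fin.cons x v : Fin (n + 1) → G)) :=
      Subgroup.closure_mono (by simp [Fin.range_cons])
    by_cases htop : Subgroup.closure (Set.range v) = ⊤
    · exact ⟨Fin.cons 1 v, Or.inl (top_le_iff.mp (htop ▸ hle 1))⟩
    · obtain ⟨x, hx⟩ : ∃ x, x ∉ Subgroup.closure (Set.range v) := by
        simpa [Subgroup.eq_top_iff'] using htop
      have hlt := (hle x).lt_of_not_ge fun h ↦ hx (h (Subgroup.subset_closure ⟨0, rfl⟩))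
      refine ⟨Fin.cons x v, Or.inr ?_⟩
      have := Subgroup.two_mul_card_le_card_of_lt hlt
      have := hv.resolve_left htop
      rw [pow_succ]
      omega

theorem exists_closure_range_eq_top_of_card_le_two_pow {G : Type*} [Group G] [Finite G] {n : ℕ}
    (h : Nat.card G ≤ 2 ^ n) : ∃ v : Fin n → G, Subgroup.closure (Set.range v) = ⊤ := by
  obtain ⟨v, hv⟩ := exists_closure_range_eq_top_or_two_pow_le_card G n
  exact ⟨v, hv.elim id fun hv ↦ Subgroup.eq_top_of_le_card _ (h.trans hv)⟩

theorem FreeGroup.lift_surjective_of_closure_eq_top {α G : Type*} [Group G] {f : α → G}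
    (h : Subgroup.closure (Set.range f) = ⊤) : Function.Surjective (FreeGroup.lift f) := by
  rw [← MonoidHom.range_eq_top, FreeGroup.range_lift_eq_closure, h]

/-- If `G` is a finite group of order `g ≥ 2`, `d = ⌈log₂ g⌉` and `m ≥ d`, then
there are at least `g ^ (m - d)` surjective homomorphisms from the free group
on `m` generators onto `G`. -/
theorem card_surjective_homs_from_free_group_ge
    (G : Type*) [Group G] [Finite G] (g : ℕ) (hg : Nat.card G = g) (hg2 : 2 ≤ g)
    (m : ℕ) (hm : Nat.clog 2 g ≤ m) :
    g ^ (m - Nat.clog 2 g) ≤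
      Nat.card {f : FreeGroup (Fin m) →* G // Function.Surjective f} := by
  obtain ⟨v, hv⟩ := exists_closure_range_eq_top_of_card_le_two_pow (G := G)
    (hg.trans_le (Nat.le_pow_clog one_lt_two g))
  obtain ⟨k, rfl⟩ := Nat.exists_eq_add_of_le hm
  have hsurj (w : Fin k → G) : Function.Surjective (FreeGroup.lift (Fin.append v w)) := by
    refine FreeGroup.lift_surjective_of_closure_eq_top (top_le_iff.mp (hv ▸ ?_))
    refine Subgroup.closure_mono ?_
    rintro _ ⟨i, rfl⟩
    exact ⟨Fin.castAdd k i, Fin.append_left v w i⟩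
  have hinj : Function.Injective fun w : Fin k → G ↦
      (⟨FreeGroup.lift (Fin.append v w), hsurj w⟩ :
        {f : FreeGroup (Fin (Nat.clog 2 g + k)) →* G // Function.Surjective f}) := by
    intro w₁ w₂ h
    have happ := FreeGroup.lift.injective (Subtype.ext_iff.mp h)
    funext i
    simpa using congrFun happ (Fin.natAdd _ i)
  have : Finite (FreeGroup (Fin (Nat.clog 2 g + k)) →* G) := Finite.of_equiv _ FreeGroup.lift
  simpa [Nat.card_fun, hg] using Nat.card_le_card_of_injective _ hinj
end

section
/- Let G be a finite group of order g ≥ 2, let d = ⌈log₂ g⌉, and let m ≥ d be a natural number. Then the number of normal subgroups A of the free group F_m on m generators with F_m/A isomorphic to G is at least g^{m − 2d}. -/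
/-- A family of `k` elements can be chosen so that it generates `G` or a subgroup of order
at least `2 ^ k`. -/
theorem exists_family_closure_eq_top_or_two_pow_le_card (G : Type*) [Group G] [Finite G] (k : ℕ) :
    ∃ t : Fin k → G, Subgroup.closure (Set.range t) = ⊤ ∨
      2 ^ k ≤ Nat.card (Subgroup.closure (Set.range t)) := by
  induction k with
  | zero => exact ⟨fun _ => 1, Or.inr (by simp)⟩
  | succ k ih =>
    obtain ⟨t, ht⟩ := ih
    by_cases htop : Subgroup.closure (Set.range t) = ⊤
    · refine ⟨Fin.cons 1 t, Or.inl (top_le_iff.1 (htop ▸ Subgroup.closure_mono ?_))⟩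
      rw [Fin.range_cons]
      exact Set.subset_insert _ _
    · obtain ⟨x, -, hx⟩ := SetLike.exists_of_lt (lt_top_iff_ne_top.2 htop)
      have hcard := ht.resolve_left htop
      refine ⟨Fin.cons x t, Or.inr ?_⟩
      rw [Fin.range_cons]
      set H := Subgroup.closure (Set.range t)
      set K := Subgroup.closure (insert x (Set.range t))
      have hle : H ≤ K := Subgroup.closure_mono (Set.subset_insert _ _)
      have hxK : x ∈ K := Subgroup.subset_closure (Set.mem_insert _ _)
      obtain ⟨c, hc⟩ := Subgroup.card_dvd_of_le hle
      have hKpos : 0 < Nat.card K := Nat.card_pos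
      have hc2 : 2 ≤ c := by
        by_contra! hlt
        interval_cases c
        · omega
        · exact hx (Subgroup.eq_of_le_of_card_ge hle (by omega) ▸ hxK)
      calc 2 ^ (k + 1) = 2 ^ k * 2 := pow_succ _ _
        _ ≤ Nat.card H * c := Nat.mul_le_mul hcard hc2
        _ = Nat.card K := hc.symm

/-- A finite group `G` is generated by `⌈log₂ |G|⌉` elements. -/
theorem exists_family_clog_card_closure_eq_top (G : Type*) [Group G] [Finite G] :
    ∃ t : Fin (Nat.clog 2 (Nat.card G)) → G, Subgroup.closure (Set.range t) = ⊤ := by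
  obtain ⟨t, ht⟩ := exists_family_closure_eq_top_or_two_pow_le_card G (Nat.clog 2 (Nat.card G))
  exact ⟨t, ht.elim id fun h =>
    Subgroup.eq_top_of_le_card _ ((Nat.le_pow_clog one_lt_two _).trans h)⟩

/-- If `G` is generated by `d` elements, there are at least `|G| ^ n` surjective homomorphisms
from the free group of rank `d + n` onto `G`. -/
theorem card_pow_le_card_surjective_freeGroup_hom {G : Type*} [Group G] [Finite G] {d : ℕ}
    {t : Fin d → G} (ht : Subgroup.closure (Set.range t) = ⊤) (n : ℕ) :
    Nat.card G ^ n ≤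
      Nat.card {f : FreeGroup (Fin (d + n)) →* G // Function.Surjective f} := by
  have : Finite (FreeGroup (Fin (d + n)) →* G) := Finite.of_equiv _ FreeGroup.lift
  have hsurj (v : Fin n → G) : Function.Surjective (FreeGroup.lift (Fin.append t v)) := by
    rw [← MonoidHom.range_eq_top, FreeGroup.range_lift_eq_closure, ← top_le_iff, ← ht]
    refine Subgroup.closure_mono ?_
    rintro _ ⟨i, rfl⟩
    exact ⟨Fin.castAdd n i, Fin.append_left t v i⟩
  have hinj : Function.Injective (fun v : Fin n → G =>
      (⟨FreeGroup.lift (Fin.append t v), hsurj v⟩ :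
        {f : FreeGroup (Fin (d + n)) →* G // Function.Surjective f})) := by
    intro v w h
    have h' := FreeGroup.lift.injective (congrArg Subtype.val h)
    ext i
    simpa using congrFun h' (Fin.natAdd d i)
  simpa [Nat.card_fun] using Nat.card_le_card_of_injective _ hinj

/-- If `f` is surjective and the `f (x i)` generate `G`, a homomorphism whose kernel contains
that of `f` is determined by its values on the `x i`. -/
theorem MonoidHom.eq_of_ker_le_of_closure_eq_top {F G H ι : Type*} [Group F] [Group G] [Group H]
    {f : F →* G} {x : ι → F} (hx : Subgroup.closure (Set.range (f ∘ x)) = ⊤) {φ ψ : F →* H}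
    (hφ : f.ker ≤ φ.ker) (hψ : f.ker ≤ ψ.ker) (h : ∀ i, φ (x i) = ψ (x i)) : φ = ψ := by
  have hmap : (φ.eqLocus ψ).map f = ⊤ := by
    rw [← top_le_iff, ← hx, Subgroup.closure_le]
    rintro _ ⟨i, rfl⟩
    exact ⟨x i, h i, rfl⟩
  ext w
  obtain ⟨e, he, hew⟩ : f w ∈ (φ.eqLocus ψ).map f := hmap ▸ Subgroup.mem_top _
  have hk : e⁻¹ * w ∈ f.ker := by simp [MonoidHom.mem_ker, hew]
  have h1 : φ e = φ w := by simpa [MonoidHom.mem_ker, inv_mul_eq_one] using hφ hk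
  have h2 : ψ e = ψ w := by simpa [MonoidHom.mem_ker, inv_mul_eq_one] using hψ hk
  rw [← h1, ← h2]
  exact he

/-- If `G` is generated by `d` elements, each kernel of a surjective homomorphism `F → G`
arises from at most `|G| ^ d` such homomorphisms. -/
theorem card_surjective_hom_le_card_ker_mul {F G : Type*} [Group F] [Group G] [Finite G]
    [Finite (F →* G)] {d : ℕ} {t : Fin d → G} (ht : Subgroup.closure (Set.range t) = ⊤) :
    Nat.card {f : F →* G // Function.Surjective f} ≤
      Nat.card {A : Subgroup F // A.Normal ∧ ∃ f : F →* G, Function.Surjective f ∧ f.ker = A} *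
        Nat.card G ^ d := by
  let 𝒦 := {A : Subgroup F // A.Normal ∧ ∃ f : F →* G, Function.Surjective f ∧ f.ker = A}
  let toKer (f : {f : F →* G // Function.Surjective f}) : 𝒦 :=
    ⟨f.1.ker, inferInstance, f.1, f.2, rfl⟩
  have : Finite 𝒦 := Finite.of_surjective toKer fun ⟨_, _, f, hf, hA⟩ =>
    ⟨⟨f, hf⟩, Subtype.ext hA⟩
  choose p hp hpker using fun A : 𝒦 => A.2.2
  choose x hx using fun (A : 𝒦) (i : Fin d) => hp A (t i)
  have hinj : Function.Injective fun f : {f : F →* G // Function.Surjective f} =>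
      (toKer f, fun i => f.1 (x (toKer f) i)) := by
    intro φ ψ h
    obtain ⟨hker, hval⟩ := Prod.ext_iff.1 h
    have hker : toKer φ = toKer ψ := hker
    refine Subtype.ext (MonoidHom.eq_of_ker_le_of_closure_eq_top
      (f := p (toKer φ)) (x := x (toKer φ)) ?_ (hpker (toKer φ)).le ?_ fun i => ?_)
    · rw [show p (toKer φ) ∘ x (toKer φ) = t from funext (hx _), ht]
    · rw [hker]
      exact (hpker (toKer ψ)).le
    · have hi : φ.1 (x (toKer φ) i) = ψ.1 (x (toKer ψ) i) := congrFun hval i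
      rw [hi, hker]
  simpa [Nat.card_prod, Nat.card_fun, 𝒦] using Nat.card_le_card_of_injective _ hinj

/-- If `G` is a finite group of order `g ≥ 2`, `d = ⌈log₂ g⌉` and `m ≥ d`, then the
number of normal subgroups `A` of the free group `F_m` on `m` generators with
`F_m/A ≅ G` (equivalently, kernels of surjective homomorphisms `F_m → G`) is at
least `g ^ (m - 2d)`. -/
theorem card_normal_subgroups_with_quotient_iso_ge
    (G : Type*) [Group G] [Finite G] (g : ℕ) (hg : Nat.card G = g) (hg2 : 2 ≤ g)
    (m : ℕ) (hm : Nat.clog 2 g ≤ m) :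
    (g : ℝ) ^ ((m : ℤ) - 2 * Nat.clog 2 g) ≤
      (Nat.card {A : Subgroup (FreeGroup (Fin m)) // A.Normal ∧
        ∃ f : FreeGroup (Fin m) →* G, Function.Surjective f ∧ f.ker = A} : ℝ) := by
  subst hg
  obtain ⟨t, ht⟩ := exists_family_clog_card_closure_eq_top G
  obtain ⟨n, rfl⟩ := Nat.exists_eq_add_of_le hm
  have : Finite (FreeGroup (Fin (Nat.clog 2 (Nat.card G) + n)) →* G) :=
    Finite.of_equiv _ FreeGroup.lift
  have hle := (card_pow_le_card_surjective_freeGroup_hom ht n).trans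
    (card_surjective_hom_le_card_ker_mul ht)
  have hg0 : (0 : ℝ) < Nat.card G := by exact_mod_cast Nat.card_pos
  rw [show ((Nat.clog 2 (Nat.card G) + n : ℕ) : ℤ) - 2 * Nat.clog 2 (Nat.card G) =
      (n : ℤ) - (Nat.clog 2 (Nat.card G) : ℕ) by
    push_cast; ring, zpow_sub₀ hg0.ne', zpow_natCast, zpow_natCast, div_le_iff₀ (by positivity)]
  exact_mod_cast hle
end
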